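/- arXiv:1510.08258 — 2 statements merged into one kernel-verified Lean document; each statement's English description precedes it below -/
import Mathlib

section
/- (h-numbers of the almost cyclic polytope.) Let d ≥ 2, s ≥ 0, n > d+s, let C(d,n,s) be the almost cyclic polytope with non-simplex facet F, and let C' be the complex of all proper faces of C(d,n,s) except F. Then h_k(C') = C(n−d−1+k, k) for 0 ≤ k ≤ ⌊(d−1)/2⌋, and h_{d−k}(C') = C(n−d−1+k, k) − C(s+k−1, k) for 1 ≤ k ≤ ⌊d/2⌋, where C(a,b) denotes the binomial coefficient. -/
open Finset

namespace ASP

noncomputable section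

/-- The dot product of two vectors in `ℝ^d`. -/
def dotp {d : ℕ} (x y : Fin d → ℝ) : ℝ := ∑ i, x i * y i

/-- `F` is a face of the polytope `P ⊆ ℝ^d`: the intersection of `P` with a supporting
hyperplane, together with the empty face and `P` itself. -/
def IsFaceOf {d : ℕ} (P F : Set (Fin d → ℝ)) : Prop :=
  F = ∅ ∨ F = P ∨
    ∃ (b : Fin d → ℝ) (c : ℝ), b ≠ 0 ∧ (∀ x ∈ P, dotp b x ≤ c) ∧
      F = {x ∈ P | dotp b x = c}

/-- The dimension of a subset of `ℝ^d`: the dimension of its affine span. -/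
def polyDim {d : ℕ} (S : Set (Fin d → ℝ)) : ℕ :=
  Module.finrank ℝ (affineSpan ℝ S).direction

/-- A polytope: the convex hull of a finite point set. -/
def IsPolytope {d : ℕ} (P : Set (Fin d → ℝ)) : Prop :=
  ∃ V : Finset (Fin d → ℝ), P = convexHull ℝ (V : Set (Fin d → ℝ))

/-- The vertex set of a polytope: its set of extreme points. -/
def verts {d : ℕ} (P : Set (Fin d → ℝ)) : Set (Fin d → ℝ) :=
  Set.extremePoints ℝ P

/-- `fVec P i` is the number of `i`-dimensional (nonempty) faces of `P`. -/
def fVec {d : ℕ} (P : Set (Fin d → ℝ)) (i : ℕ) : ℕ :=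
  {F : Set (Fin d → ℝ) | IsFaceOf P F ∧ F.Nonempty ∧ polyDim F = i}.ncard

/-- A facet of a `d`-polytope in `ℝ^d`: a `(d-1)`-dimensional face. -/
def IsFacetOf {d : ℕ} (P F : Set (Fin d → ℝ)) : Prop :=
  IsFaceOf P F ∧ F.Nonempty ∧ polyDim F = d - 1

/-- `(P, F)` is an ASP-pair: `P` is a `d`-polytope, `F` is a facet of `P`, and every facet
of `P` other than `F` is a simplex (i.e. has exactly `d` vertices). -/
def IsASPPair {d : ℕ} (P F : Set (Fin d → ℝ)) : Prop :=
  IsPolytope P ∧ polyDim P = d ∧ IsFacetOf P F ∧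
    ∀ G, IsFacetOf P G → G ≠ F → (verts G).ncard = d

/-- `P ∈ 𝒫(d,n,s)`: `P` is a `d`-polytope with `n` vertices such that `(P,F)` is an
ASP-pair where the facet `F` has `d + s` vertices. -/
def MemASP (d n s : ℕ) (P : Set (Fin d → ℝ)) : Prop :=
  (verts P).ncard = n ∧ ∃ F, IsASPPair P F ∧ (verts F).ncard = d + s

/-- `fBall P i` is `f_{i-1}(P')` of the simplicial ball `P' = ∂P - {F}` consisting of all
proper faces of `P` except its (unique non-simplex) facet `F`; the index is shifted by one,
so `fBall P 0 = f_{-1} = 1` counts the empty face, and at the top dimension the facet `F`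
is discarded. -/
def fBall {d : ℕ} (P : Set (Fin d → ℝ)) (i : ℕ) : ℤ :=
  if i = 0 then 1
  else if i = d then (fVec P (d - 1) : ℤ) - 1
  else if d < i then 0
  else (fVec P (i - 1) : ℤ)

/-- `hBall P k` is `h_k(P')` of the `(d-1)`-dimensional ball `P' = ∂P - {F}`, defined by
`h_k = ∑_{i=0}^{k} (-1)^{k-i} C(d-i, k-i) f_{i-1}(P')`, extended by `0` outside `0 ≤ k ≤ d`. -/
def hBall {d : ℕ} (P : Set (Fin d → ℝ)) (k : ℤ) : ℤ :=
  if 0 ≤ k ∧ k ≤ (d : ℤ) then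
    ∑ i ∈ Finset.range (k.toNat + 1),
      (-1) ^ (k.toNat - i) * ((d - i).choose (k.toNat - i) : ℤ) * fBall P i
  else 0

/-- `fBd m Q i` is `f_{i-1}(∂Q)` of the boundary complex of an `m`-polytope `Q ⊆ ℝ^d`
(a complex of dimension `m - 1`); the index is shifted by one. -/
def fBd {d : ℕ} (m : ℕ) (Q : Set (Fin d → ℝ)) (i : ℕ) : ℤ :=
  if i = 0 then 1 else if m + 1 ≤ i then 0 else (fVec Q (i - 1) : ℤ)

/-- `hBd m Q k` is `h_k(∂Q)` for the boundary complex of an `m`-polytope `Q ⊆ ℝ^d`, defined by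
`h_k = ∑_{i=0}^{k} (-1)^{k-i} C(m-i, k-i) f_{i-1}(∂Q)`, extended by `0` outside `0 ≤ k ≤ m`. -/
def hBd {d : ℕ} (m : ℕ) (Q : Set (Fin d → ℝ)) (k : ℤ) : ℤ :=
  if 0 ≤ k ∧ k ≤ (m : ℤ) then
    ∑ i ∈ Finset.range (k.toNat + 1),
      (-1) ^ (k.toNat - i) * ((m - i).choose (k.toNat - i) : ℤ) * fBd m Q i
  else 0

/-- `gBd m Q k = g_k(∂Q) = h_k(∂Q) - h_{k-1}(∂Q)`. -/
def gBd {d : ℕ} (m : ℕ) (Q : Set (Fin d → ℝ)) (k : ℤ) : ℤ :=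
  hBd m Q k - hBd m Q (k - 1)

/-- The function `p(t) = (n-1)^{(t-1)(d-1)} · t(t+1)⋯(t+d+s-1)` (real exponentiation of the
positive base `n-1`) used to define the almost cyclic polytope. -/
def acp (d n s : ℕ) (t : ℝ) : ℝ :=
  ((n : ℝ) - 1) ^ ((t - 1) * ((d : ℝ) - 1)) * ∏ l ∈ Finset.range (d + s), (t + l)

/-- The curve `y(t) = (t, t², …, t^{d-1}, p(t)) ∈ ℝ^d`. -/
def acy (d n s : ℕ) (t : ℝ) : Fin d → ℝ :=
  fun i => if (i : ℕ) + 1 = d then acp d n s t else t ^ ((i : ℕ) + 1)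

/-- The parameter values `t_i = -s - d + i` for `i = 1, …, n` (here `0`-indexed:
`acT d s j = t_{j+1}`). -/
def acT (d s j : ℕ) : ℝ := (j : ℝ) + 1 - s - d

/-- The `n` points `y(t_1), …, y(t_n)` on the curve `y` (`0`-indexed). -/
def acPoint (d n s : ℕ) (j : Fin n) : Fin d → ℝ := acy d n s (acT d s (j : ℕ))

/-- The almost cyclic polytope `C(d,n,s) = conv{y(t_1), …, y(t_n)}`. -/
def acPolytope (d n s : ℕ) : Set (Fin d → ℝ) :=
  convexHull ℝ (Set.range (acPoint d n s))

/-- The non-simplex facet `F = conv{y(t_1), …, y(t_{d+s})}` of the almost cyclic polytope. -/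
def acFacet (d n s : ℕ) : Set (Fin d → ℝ) :=
  convexHull ℝ (acPoint d n s '' {j : Fin n | (j : ℕ) < d + s})

/-- The generalized moment curve
`x(t) = (t, t², …, t^{d-r}, p_1(t), …, p_r(t)) ∈ ℝ^d`. -/
def gmc (d r : ℕ) (p : Fin r → ℝ → ℝ) (t : ℝ) : Fin d → ℝ :=
  fun i =>
    if h : (i : ℕ) < d - r then t ^ ((i : ℕ) + 1)
    else p ⟨(i : ℕ) - (d - r), by have h2 := i.2; omega⟩ t

/-- A polytope is `k`-neighborly if each subset of at most `k` of its vertices is the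
vertex set of a face. -/
def IsNeighborly {d : ℕ} (k : ℕ) (P : Set (Fin d → ℝ)) : Prop :=
  ∀ S : Finset (Fin d → ℝ), (S : Set (Fin d → ℝ)) ⊆ verts P → S.card ≤ k →
    ∃ G : Set (Fin d → ℝ), IsFaceOf P G ∧ verts G = (S : Set (Fin d → ℝ))

/-- The point `y` is beyond the facet `F` of the polytope `P`: for every supporting
hyperplane of `P` cutting out a facet, `y` is strictly on the outer side if the facet is `F`,
and strictly on the inner side otherwise. -/
def IsBeyond {d : ℕ} (P F : Set (Fin d → ℝ)) (y : Fin d → ℝ) : Prop :=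
  ∀ (b : Fin d → ℝ) (c : ℝ), b ≠ 0 → (∀ x ∈ P, dotp b x ≤ c) →
    IsFacetOf P {x ∈ P | dotp b x = c} →
      (({x ∈ P | dotp b x = c} = F → c < dotp b y) ∧
       ({x ∈ P | dotp b x = c} ≠ F → dotp b y < c))

/-- number of elements of `S` above `y` -/
def upc (S : Finset ℕ) (y : ℕ) : ℕ := (S.filter (fun x => y < x)).card

def IsGale (n : ℕ) (S : Finset ℕ) : Prop :=
  ∃ e : ℕ, ∀ y, y < n → y ∉ S → upc S y % 2 = e

open Classical in
def rset (n : ℕ) (S : Finset ℕ) : Finset ℕ :=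
  S.filter (fun j => ∃ g, g < n ∧ g ∉ S ∧ j < g ∧
    (upc S j % 2 ≠ upc S g % 2 ∨ ∀ i, i < j → i ∈ S))

open Classical in
def galeSets (n d : ℕ) : Finset (Finset ℕ) :=
  (Finset.powersetCard d (Finset.range n)).filter (fun S => IsGale n S)

open Classical in
def galeHi (n d m : ℕ) : Finset (Finset ℕ) :=
  (galeSets n d).filter (fun S => ¬ S ⊆ Finset.range m)

open Classical in
def galeLo (n d m : ℕ) : Finset (Finset ℕ) :=
  (galeSets n d).filter (fun S => S ⊆ Finset.range m)

lemma upc_split (S : Finset ℕ) {x y : ℕ} (h : x < y) :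
    upc S x = (S.filter (fun z => x < z ∧ z < y)).card + (if y ∈ S then 1 else 0) + upc S y := by
  unfold upc
  have h1 : S.filter (fun z => x < z) = S.filter (fun z => x < z ∧ z < y) ∪
      (S.filter (fun z => z = y) ∪ S.filter (fun z => y < z)) := by
    ext z; simp only [mem_filter, mem_union]
    by_cases hz : z ∈ S <;> simp [hz]; omega
  rw [h1, card_union_of_disjoint, card_union_of_disjoint, ← add_assoc]
  · congr 2
    rw [Finset.filter_eq']
    split_ifs <;> simp
  · rw [Finset.disjoint_filter]; intros; omega
  · rw [← Finset.filter_or, Finset.disjoint_filter]; intros; omega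

lemma upc_exchange (S : Finset ℕ) {j g : ℕ} (hj : j ∈ S) (hg : g ∉ S) (y : ℕ) :
    upc (insert g (S.erase j)) y + (if y < j then 1 else 0)
      = upc S y + (if y < g then 1 else 0) := by
  unfold upc
  rw [Finset.filter_insert, Finset.filter_erase]
  have hjm : y < j → j ∈ S.filter (fun x => y < x) := fun h => by simp [hj, h]
  have hgm : g ∉ (S.filter (fun x => y < x)).erase j := by simp [hg]
  split_ifs with h1 h2 h2
  · rw [card_insert_of_notMem hgm, card_erase_add_one (hjm h2)]
  · rw [card_insert_of_notMem hgm, erase_eq_of_notMem]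
    · simp [h2]
  · rw [card_erase_add_one (hjm h2)]; rfl
  · rw [erase_eq_of_notMem]
    · simp [h2]

lemma card_exchange (S : Finset ℕ) {j g : ℕ} (hj : j ∈ S) (hg : g ∉ S) :
    (insert g (S.erase j)).card = S.card := by
  rw [card_insert_of_notMem (by simp [hg]), card_erase_add_one hj]

lemma sum_exchange (S : Finset ℕ) {j g : ℕ} (hj : j ∈ S) (hg : g ∉ S) :
    (∑ x ∈ insert g (S.erase j), x) + j = (∑ x ∈ S, x) + g := by
  rw [sum_insert (by simp [hg])]
  have := Finset.sum_erase_add S (fun x => x) hj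
  omega

/-- raising exchange -/
lemma raise_exists {n : ℕ} {S : Finset ℕ} (hS : IsGale n S) {j : ℕ}
    (hj : j ∈ rset n S) : ∃ g, g < n ∧ g ∉ S ∧ j < g ∧ IsGale n (insert g (S.erase j)) := by
  classical
  obtain ⟨e, he⟩ := hS
  simp only [rset, mem_filter] at hj
  obtain ⟨hjS, g, hgn, hgS, hjg, hor⟩ := hj
  by_cases hp : upc S j % 2 ≠ upc S g % 2
  · -- next gap
    have hex : ∃ g, g < n ∧ g ∉ S ∧ j < g := ⟨g, hgn, hgS, hjg⟩
    obtain ⟨g0, ⟨h1, h2, h3⟩, hmin⟩ : ∃ g0, (g0 < n ∧ g0 ∉ S ∧ j < g0) ∧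
        ∀ y, y < g0 → ¬ (y < n ∧ y ∉ S ∧ j < y) :=
      ⟨Nat.find hex, Nat.find_spec hex, fun y hy => Nat.find_min hex hy⟩
    refine ⟨g0, h1, h2, h3, e, ?_⟩
    intro y hy hyS
    have hx := upc_exchange S hjS h2 y
    have hg0 := he g0 h1 h2
    have hg := he g hgn hgS
    simp only [mem_insert, mem_erase, not_or, not_and] at hyS
    by_cases hyj : y = j
    · subst hyj
      rw [if_neg (lt_irrefl _), if_pos h3] at hx
      omega
    · have hyS' : y ∉ S := fun h => (hyS.2 hyj) h
      have hyy := he y hy hyS'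
      by_cases hy1 : y < j
      · rw [if_pos hy1, if_pos (by omega)] at hx; omega
      · have := hmin y
        have h5 : ¬ y < g0 := fun h => this h ⟨hy, hyS', by omega⟩
        rw [if_neg hy1, if_neg h5] at hx; omega
  · have hb : ∀ i, i < j → i ∈ S := by tauto
    push Not at hp
    -- max gap
    obtain ⟨h, hmem, hmax⟩ := Finset.exists_max_image ((Finset.range n).filter (fun y => y ∉ S)) id
      ⟨g, by simp [hgn, hgS]⟩
    simp only [mem_filter, mem_range, id] at hmem hmax
    have hgh := hmax g ⟨hgn, hgS⟩
    refine ⟨h, hmem.1, hmem.2, by omega, (e+1) % 2, ?_⟩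
    intro y hy hyS
    have hx := upc_exchange S hjS hmem.2 y
    have hg := he g hgn hgS
    simp only [mem_insert, mem_erase, not_or, not_and] at hyS
    by_cases hyj : y = j
    · subst hyj
      rw [if_neg (lt_irrefl _), if_pos (by omega)] at hx
      omega
    · have hyS' : y ∉ S := fun h => (hyS.2 hyj) h
      have hyy := he y hy hyS'
      have := hmax y ⟨hy, hyS'⟩
      have h3 : ¬ y < j := fun h => hyS' (hb y h)
      rw [if_neg h3, if_pos (by omega)] at hx; omega

/-- lowering exchange; second part: if the top element `n-1` is missing ... -/
lemma lower_exists {n : ℕ} {S : Finset ℕ} (hS : IsGale n S) (hSn : S ⊆ Finset.range n)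
    (hc : S.card < n) {j : ℕ}
    (hjS : j ∈ S) (hj : j ∉ rset n S) :
    ∃ g, g < j ∧ g ∉ S ∧ IsGale n (insert g (S.erase j)) := by
  classical
  obtain ⟨e, he⟩ := hS
  have hjn : j < n := by simpa using hSn hjS
  simp only [rset, mem_filter, not_and, not_exists] at hj
  have hj := hj hjS
  have hgap : ∃ g, g < n ∧ g ∉ S := by
    by_contra hcon
    push Not at hcon
    have : Finset.range n ⊆ S := fun x hx => hcon x (by simpa using hx)
    have := card_le_card this
    simp at this; omega
  have hbelow : ∃ i, i < j ∧ i ∉ S := by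
    by_contra hcon
    push Not at hcon
    obtain ⟨g, hg, hgS⟩ := hgap
    have : j < g := by
      rcases lt_trichotomy j g with h | h | h
      · exact h
      · subst h; exact absurd hjS hgS
      · exact absurd (hcon g h) hgS
    exact hj g hg hgS this (Or.inr hcon)
  obtain ⟨i, hij, hiS⟩ := hbelow
  have hi := he i (by omega) hiS
  by_cases hp : upc S j % 2 = e
  · obtain ⟨g, hmem, hmax⟩ := Finset.exists_max_image ((Finset.range j).filter (fun y => y ∉ S)) id
      ⟨i, by simp [hij, hiS]⟩
    simp only [mem_filter, mem_range, id] at hmem hmax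
    refine ⟨g, hmem.1, hmem.2, e, ?_⟩
    intro y hy hyS
    have hx := upc_exchange S hjS hmem.2 y
    simp only [mem_insert, mem_erase, not_or, not_and] at hyS
    by_cases hyj : y = j
    · subst hyj
      rw [if_neg (lt_irrefl _), if_neg (by omega)] at hx
      omega
    · have hyS' : y ∉ S := fun h => (hyS.2 hyj) h
      have hyy := he y hy hyS'
      by_cases hy1 : y < j
      · have := hmax y ⟨hy1, hyS'⟩
        rw [if_pos hy1, if_pos (by omega)] at hx; omega
      · rw [if_neg hy1, if_neg (by omega)] at hx; omega
  · have hno : ∀ g, g < n → g ∉ S → g < j := by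
      intro g hg hgS
      by_contra hcon
      have h1 : j < g := by
        rcases lt_trichotomy j g with h | h | h
        · exact h
        · subst h; exact absurd hjS hgS
        · exact absurd h hcon
      refine hj g hg hgS h1 (Or.inl ?_)
      rw [he g hg hgS]; exact hp
    obtain ⟨g, hmem, hmin⟩ := Finset.exists_min_image ((Finset.range j).filter (fun y => y ∉ S)) id
      ⟨i, by simp [hij, hiS]⟩
    simp only [mem_filter, mem_range, id] at hmem hmin
    refine ⟨g, hmem.1, hmem.2, (e+1)%2, ?_⟩
    intro y hy hyS
    have hx := upc_exchange S hjS hmem.2 y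
    simp only [mem_insert, mem_erase, not_or, not_and] at hyS
    by_cases hyj : y = j
    · subst hyj
      rw [if_neg (lt_irrefl _), if_neg (by omega)] at hx
      omega
    · have hyS' : y ∉ S := fun h => (hyS.2 hyj) h
      have hyy := he y hy hyS'
      have h1 := hno y hy hyS'
      have := hmin y ⟨h1, hyS'⟩
      have : y ≠ g := hyS.1
      rw [if_pos h1, if_neg (by omega)] at hx; omega

lemma raise_unique_aux {n : ℕ} {S T Z : Finset ℕ} (hS : IsGale n S) (hT : IsGale n T)
    (hSn : S ⊆ Finset.range n) (hTn : T ⊆ Finset.range n) (hc : S.card = T.card)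
    (hRS : rset n S ⊆ Z) (hZT : Z ⊆ T) {x : ℕ} (hxS : x ∈ S) (hxT : x ∉ T)
    (hag : ∀ y, y < x → (y ∈ S ↔ y ∈ T)) : False := by
  classical
  have hxn : x < n := by simpa using hSn hxS
  have hxR : x ∉ rset n S := fun h => hxT (hZT (hRS h))
  simp only [rset, mem_filter, not_and, not_exists] at hxR
  have hxR := hxR hxS
  by_cases hg : ∃ g, g < n ∧ g ∉ S ∧ x < g
  · obtain ⟨g, hgn, hgS, hxg⟩ := hg
    have h := hxR g hgn hgS hxg
    push Not at h
    obtain ⟨hpar, i, hix, hiS⟩ := h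
    have hiT : i ∉ T := fun h => hiS ((hag i hix).2 h)
    obtain ⟨e, he⟩ := hS
    obtain ⟨e', he'⟩ := hT
    have h1 := he i (by omega) hiS
    have h2 := he g hgn hgS
    have h3 := he' i (by omega) hiT
    have h4 := he' x hxn hxT
    have h5 := upc_split S hix
    have h6 := upc_split T hix
    rw [if_pos hxS] at h5
    rw [if_neg hxT] at h6
    have h7 : S.filter (fun z => i < z ∧ z < x) = T.filter (fun z => i < z ∧ z < x) := by
      ext z; simp only [mem_filter]
      constructor
      · rintro ⟨a, b, c⟩; exact ⟨(hag z c).1 a, b, c⟩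
      · rintro ⟨a, b, c⟩; exact ⟨(hag z c).2 a, b, c⟩
    rw [h7] at h5
    omega
  · push Not at hg
    have : T ⊂ S := by
      refine ⟨?_, fun h => hxT (h hxS)⟩
      intro y hy
      have hyn : y < n := by simpa using hTn hy
      rcases lt_trichotomy y x with h | h | h
      · exact (hag y h).2 hy
      · subst h; exact hxS
      · by_contra hcon
        have := hg y hyn hcon
        omega
    have := card_lt_card this
    omega

lemma lower_unique_aux {n : ℕ} {S T Z : Finset ℕ} (hT : IsGale n T)
    (hSn : S ⊆ Finset.range n) (hc : S.card = T.card)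
    (hRS : S \ rset n S ⊆ Z) (hZT : Z ⊆ T) {x : ℕ} (hxS : x ∈ S) (hxT : x ∉ T)
    (hag : ∀ y, x < y → (y ∈ S ↔ y ∈ T)) : False := by
  classical
  have hxn : x < n := by simpa using hSn hxS
  have hxR : x ∈ rset n S := by
    by_contra h
    exact hxT (hZT (hRS (by simp [hxS, h])))
  simp only [rset, mem_filter] at hxR
  obtain ⟨-, g, hgn, hgS, hxg, hor⟩ := hxR
  have hup : ∀ y, x ≤ y → upc S y = upc T y := by
    intro y hy
    unfold upc
    congr 1
    ext z; simp only [mem_filter]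
    constructor
    · rintro ⟨a, b⟩; exact ⟨(hag z (by omega)).1 a, b⟩
    · rintro ⟨a, b⟩; exact ⟨(hag z (by omega)).2 a, b⟩
  rcases hor with h | h
  · obtain ⟨e', he'⟩ := hT
    have h1 := he' x hxn hxT
    have h2 := he' g hgn (fun h => hgS ((hag g hxg).2 h))
    rw [hup x le_rfl, hup g hxg.le] at h
    omega
  · have : T ⊂ S := by
      refine ⟨?_, fun h => hxT (h hxS)⟩
      intro y hy
      rcases lt_trichotomy y x with h' | h' | h'
      · exact h y h'
      · subst h'; exact hxS
      · exact (hag y h').2 hy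
    have := card_lt_card this
    omega

lemma raise_unique {n : ℕ} {S T Z : Finset ℕ} (hS : IsGale n S) (hT : IsGale n T)
    (hSn : S ⊆ Finset.range n) (hTn : T ⊆ Finset.range n) (hc : S.card = T.card)
    (hRS : rset n S ⊆ Z) (hRT : rset n T ⊆ Z) (hZS : Z ⊆ S) (hZT : Z ⊆ T) : S = T := by
  classical
  by_contra hne
  have hex : ∃ x, ¬ (x ∈ S ↔ x ∈ T) := by
    by_contra h; push Not at h; exact hne (Finset.ext h)
  have h1 := Nat.find_spec hex
  have h2 : ∀ y, y < Nat.find hex → (y ∈ S ↔ y ∈ T) := fun y hy => not_not.1 (Nat.find_min hex hy)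
  by_cases hx : Nat.find hex ∈ S
  · exact raise_unique_aux hS hT hSn hTn hc hRS hZT hx (by tauto) h2
  · exact raise_unique_aux hT hS hTn hSn hc.symm hRT hZS (by tauto) hx (fun y hy => (h2 y hy).symm)

lemma lower_unique {n : ℕ} {S T Z : Finset ℕ} (hS : IsGale n S) (hT : IsGale n T)
    (hSn : S ⊆ Finset.range n) (hTn : T ⊆ Finset.range n) (hc : S.card = T.card)
    (hRS : S \ rset n S ⊆ Z) (hRT : T \ rset n T ⊆ Z) (hZS : Z ⊆ S) (hZT : Z ⊆ T) : S = T := by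
  classical
  by_contra hne
  have hne' : ((Finset.range n).filter (fun x => ¬ (x ∈ S ↔ x ∈ T))).Nonempty := by
    by_contra h
    rw [Finset.not_nonempty_iff_eq_empty, Finset.filter_eq_empty_iff] at h
    refine hne (Finset.ext fun x => ?_)
    by_cases hx : x < n
    · exact not_not.1 (h (by simpa using hx))
    · constructor
      · intro h; exact absurd (by simpa using hSn h) hx
      · intro h; exact absurd (by simpa using hTn h) hx
  obtain ⟨x, hx, hmax⟩ := Finset.exists_max_image _ id hne'
  simp only [mem_filter, mem_range, id] at hx hmax
  have h2 : ∀ y, x < y → (y ∈ S ↔ y ∈ T) := by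
    intro y hy
    by_contra hcon
    by_cases hyn : y < n
    · have := hmax y ⟨hyn, hcon⟩; omega
    · apply hcon
      constructor
      · intro h; exact absurd (by simpa using hSn h) hyn
      · intro h; exact absurd (by simpa using hTn h) hyn
  by_cases hxS : x ∈ S
  · exact lower_unique_aux hT hSn hc hRS hZT hxS (by tauto) h2
  · exact lower_unique_aux hS hTn hc.symm hRT hZS (by tauto) hxS (fun y hy => (h2 y hy).symm)

lemma mem_galeSets {n d : ℕ} {S : Finset ℕ} :
    S ∈ galeSets n d ↔ S ⊆ Finset.range n ∧ S.card = d ∧ IsGale n S := by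
  simp [galeSets, mem_powersetCard, and_assoc]

lemma mem_galeHi {n d m : ℕ} {S : Finset ℕ} :
    S ∈ galeHi n d m ↔ S ∈ galeSets n d ∧ ¬ S ⊆ Finset.range m := by
  simp [galeHi]

lemma mem_galeLo {n d m : ℕ} {S : Finset ℕ} :
    S ∈ galeLo n d m ↔ S ∈ galeSets n d ∧ S ⊆ Finset.range m := by
  simp [galeLo]

lemma exchange_mem {n d : ℕ} {S : Finset ℕ} (hS : S ∈ galeSets n d) {j g : ℕ} (hj : j ∈ S)
    (hg : g ∉ S) (hgn : g < n) (hG : IsGale n (insert g (S.erase j))) :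
    insert g (S.erase j) ∈ galeSets n d := by
  rw [mem_galeSets] at hS ⊢
  refine ⟨?_, ?_, hG⟩
  · intro x hx
    simp only [mem_insert, mem_erase] at hx
    rcases hx with rfl | hx
    · simpa using hgn
    · exact hS.1 hx.2
  · rw [card_exchange S hj hg, hS.2.1]

lemma exchange_sup {S Z : Finset ℕ} {j g : ℕ} (hZ : Z ⊆ S) (hjZ : j ∉ Z) :
    Z ⊆ insert g (S.erase j) := by
  intro x hx
  have : x ≠ j := by rintro rfl; exact hjZ hx
  simp [this, hZ hx]

lemma raise_partition {n d m : ℕ} {Z : Finset ℕ} (hZ : ∃ S ∈ galeHi n d m, Z ⊆ S) :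
    ∃ S ∈ galeHi n d m, rset n S ⊆ Z ∧ Z ⊆ S := by
  classical
  obtain ⟨S0, hS0, hZ0⟩ := hZ
  obtain ⟨S, hS, hmax⟩ := Finset.exists_max_image ((galeHi n d m).filter (fun S => Z ⊆ S))
    (fun S => ∑ x ∈ S, x) ⟨S0, by simp [hS0, hZ0]⟩
  simp only [mem_filter] at hS hmax
  refine ⟨S, hS.1, ?_, hS.2⟩
  intro j hj
  by_contra hjZ
  have hS1 := mem_galeHi.1 hS.1
  have hS2 := mem_galeSets.1 hS1.1
  have hjS : j ∈ S := by simp only [rset, mem_filter] at hj; exact hj.1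
  obtain ⟨g, hgn, hgS, hjg, hG⟩ := raise_exists hS2.2.2 hj
  have hmem := exchange_mem hS1.1 hjS hgS hgn hG
  have := hmax _ ⟨mem_galeHi.2 ⟨hmem, ?_⟩, exchange_sup (g := g) hS.2 hjZ⟩
  · have h3 := sum_exchange S hjS hgS
    omega
  · intro hsub
    apply hS1.2
    have hgm : g < m := by simpa using hsub (mem_insert_self _ _)
    intro x hx
    by_cases hxj : x = j
    · subst hxj; simp; omega
    · exact hsub (by simp [hxj, hx])

lemma lower_partition {n d : ℕ} (hd : d < n) (C : Finset (Finset ℕ)) (hC : C ⊆ galeSets n d)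
    (hcl : ∀ S ∈ C, ∀ j ∈ S, ∀ g, g < j → g ∉ S → insert g (S.erase j) ∈ galeSets n d →
      insert g (S.erase j) ∈ C)
    {Z : Finset ℕ} (hZ : ∃ S ∈ C, Z ⊆ S) :
    ∃ S ∈ C, S \ rset n S ⊆ Z ∧ Z ⊆ S := by
  classical
  obtain ⟨S0, hS0, hZ0⟩ := hZ
  obtain ⟨S, hS, hmin⟩ := Finset.exists_min_image (C.filter (fun S => Z ⊆ S))
    (fun S => ∑ x ∈ S, x) ⟨S0, by simp [hS0, hZ0]⟩
  simp only [mem_filter] at hS hmin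
  refine ⟨S, hS.1, ?_, hS.2⟩
  intro j hj
  by_contra hjZ
  have hS1 := hC hS.1
  have hS2 := mem_galeSets.1 hS1
  simp only [mem_sdiff] at hj
  have hjn : j < n := by simpa using hS2.1 hj.1
  obtain ⟨g, hgj, hgS, hG⟩ := lower_exists hS2.2.2 hS2.1 (by omega) hj.1 hj.2
  have hmem := exchange_mem hS1 hj.1 hgS (by omega) hG
  have := hmin _ ⟨hcl S hS.1 j hj.1 g hgj hgS hmem, exchange_sup (g := g) hS.2 hjZ⟩
  have h3 := sum_exchange S hj.1 hgS
  omega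

/-- covering lemma -/
lemma cover (m : ℕ) : ∀ (d : ℕ) (Z : Finset ℕ), d ≤ m → Z ⊆ Finset.range m → 2 * Z.card ≤ d →
    ∃ S, Z ⊆ S ∧ S ⊆ Finset.range m ∧ S.card = d ∧ ∀ y, y ∉ S → upc S y % 2 = 0 ∨ m ≤ y := by
  classical
  induction m using Nat.strong_induction_on with
  | _ m ih =>
  intro d Z hdm hZ hZd
  rcases hdm.eq_or_lt with h | h
  · subst h
    exact ⟨Finset.range d, hZ, subset_rfl, by simp, fun y hy => Or.inr (by simpa using hy)⟩
  · by_cases hm : m - 1 ∈ Z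
    · have hc : 0 < Z.card := card_pos.2 ⟨_, hm⟩
      have h1 : (Z.filter (fun z => z < m - 2)).card < Z.card := by
        apply card_lt_card
        refine ⟨filter_subset _ _, fun h => ?_⟩
        have := h hm
        simp at this; omega
      obtain ⟨S, hS1, hS2, hS3, hS4⟩ := ih (m - 2) (by omega) (d - 2) (Z.filter (fun z => z < m - 2))
        (by omega) (by intro x hx; simp at hx; simpa using hx.2) (by omega)
      have ha : m - 2 ∉ S := fun h => by simpa using hS2 h
      have hb : m - 1 ∉ insert (m - 2) S := by
        simp only [mem_insert, not_or]
        exact ⟨by omega, fun h => by have := hS2 h; simp at this; omega⟩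
      refine ⟨insert (m - 1) (insert (m - 2) S), ?_, ?_, ?_, ?_⟩
      · intro x hx
        have hxm : x < m := by simpa using hZ hx
        simp only [mem_insert]
        by_cases hx1 : x < m - 2
        · right; right; exact hS1 (by simp [hx, hx1])
        · omega
      · intro x hx
        simp only [mem_insert] at hx
        rcases hx with rfl | rfl | hx
        · simp; omega
        · simp; omega
        · have := hS2 hx; simp at this ⊢; omega
      · rw [card_insert_of_notMem hb, card_insert_of_notMem ha]; omega
      · intro y hy
        simp only [mem_insert, not_or] at hy
        by_cases hym : m ≤ y
        · right; exact hym
        · left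
          have h4 : upc (insert (m - 1) (insert (m - 2) S)) y = upc S y + 2 := by
            unfold upc
            rw [filter_insert, if_pos (by omega), filter_insert, if_pos (by omega),
              card_insert_of_notMem, card_insert_of_notMem]
            · simp [ha]
            · intro h; apply hb
              simp only [mem_insert, mem_filter] at h ⊢; tauto
          have := hS4 y hy.2.2
          rw [h4]; omega
    · have hZ' : Z ⊆ Finset.range (m - 1) := by
        intro x hx
        have hxm : x < m := by simpa using hZ hx
        have : x ≠ m - 1 := by rintro rfl; exact hm hx
        simp; omega
      obtain ⟨S, hS1, hS2, hS3, hS4⟩ := ih (m - 1) (by omega) d Z (by omega) hZ' hZd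
      refine ⟨S, hS1, hS2.trans (by intro x; simp; omega), hS3, ?_⟩
      intro y hy
      rcases hS4 y hy with h | h
      · left; exact h
      · left
        have : upc S y = 0 := by
          unfold upc
          rw [card_eq_zero, filter_eq_empty_iff]
          intro x hx
          have := hS2 hx; simp at this; omega
        omega

lemma cover_lo {n d m : ℕ} (hdm : d ≤ m) (hmn : m ≤ n) {Z : Finset ℕ} (hZ : Z ⊆ Finset.range m)
    (hZd : 2 * Z.card ≤ d) : ∃ S ∈ galeLo n d m, Z ⊆ S := by
  obtain ⟨S, hS1, hS2, hS3, hS4⟩ := cover m d Z hdm hZ hZd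
  refine ⟨S, mem_galeLo.2 ⟨mem_galeSets.2 ⟨hS2.trans (by intro x; simp; omega), hS3, 0, ?_⟩, hS2⟩, hS1⟩
  intro y hy hyS
  rcases hS4 y hyS with h | h
  · exact h
  · have : upc S y = 0 := by
      unfold upc
      rw [card_eq_zero, filter_eq_empty_iff]
      intro x hx
      have := hS2 hx; simp at this; omega
    omega

lemma cover_hi {n d m : ℕ} (hd : 1 ≤ d) (hdm : d ≤ m) (hmn : m < n) {Z : Finset ℕ}
    (hZ : Z ⊆ Finset.range n)
    (hZd : 2 * Z.card ≤ d - 1) : ∃ S ∈ galeHi n d m, Z ⊆ S := by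
  classical
  obtain ⟨S, hS1, hS2, hS3, hS4⟩ := cover (n - 1) (d - 1) (Z.erase (n - 1)) (by omega)
    (by
      intro x hx
      simp only [mem_erase] at hx
      have := hZ hx.2
      simp at this ⊢; omega) (by have := card_erase_le (s := Z) (a := n - 1); omega)
  have ha : n - 1 ∉ S := fun h => by simpa using hS2 h
  refine ⟨insert (n - 1) S, mem_galeHi.2 ⟨mem_galeSets.2 ⟨?_, ?_, 1, ?_⟩, ?_⟩, ?_⟩
  · intro x hx
    simp only [mem_insert] at hx
    rcases hx with rfl | hx
    · simp; omega
    · have := hS2 hx; simp at this ⊢; omega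
  · rw [card_insert_of_notMem ha]; omega
  · intro y hy hyS
    simp only [mem_insert, not_or] at hyS
    have h4 : upc (insert (n - 1) S) y = upc S y + 1 := by
      unfold upc
      rw [filter_insert, if_pos (by omega), card_insert_of_notMem]
      simp [ha]
    have := hS4 y hyS.2
    omega
  · intro h
    have := h (mem_insert_self _ _)
    simp at this; omega
  · intro x hx
    by_cases h : x = n - 1
    · simp [h]
    · exact mem_insert_of_mem (hS1 (by simp [h, hx]))

/-- the h-transform of an f-vector -/
def htr (d : ℕ) (f : ℕ → ℤ) (k : ℕ) : ℤ :=
  ∑ i ∈ Finset.range (k + 1), (-1) ^ (k - i) * ((d - i).choose (k - i) : ℤ) * f i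

lemma htr_unit (d k r : ℕ) (hk : k ≤ d) :
    htr d (fun i => if r ≤ i then ((d - r).choose (i - r) : ℤ) else 0) k
      = if r = k then 1 else 0 := by
  unfold htr
  by_cases hr : r ≤ k
  · obtain ⟨e, rfl⟩ := Nat.exists_eq_add_of_le hr
    obtain ⟨f, rfl⟩ := Nat.exists_eq_add_of_le hk
    rw [add_assoc r e 1, Finset.sum_range_add]
    rw [Finset.sum_eq_zero (s := Finset.range r)]
    · rw [zero_add]
      have h1 : ∀ i ∈ Finset.range (e + 1),
          (-1 : ℤ) ^ (r + e - (r + i)) * ((r + e + f - (r + i)).choose (r + e - (r + i)) : ℤ) *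
            (if r ≤ r + i then ((r + e + f - r).choose (r + i - r) : ℤ) else 0)
          = ((-1) ^ e * ((e + f).choose e : ℤ)) * ((-1) ^ i * (e.choose i : ℤ)) := by
        intro i hi
        have hi' : i ≤ e := by simpa [Nat.lt_succ_iff] using hi
        rw [if_pos (by omega)]
        have e1 : r + e - (r + i) = e - i := by omega
        have e2 : r + e + f - (r + i) = e + f - i := by omega
        have e3 : r + e + f - r = e + f := by omega
        have e4 : r + i - r = i := by omega
        rw [e1, e2, e3, e4]
        have h2 := Nat.choose_mul (n := e + f) (k := e) (s := i) hi'
        have h2' : ((e + f).choose e : ℤ) * (e.choose i : ℤ)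
          = ((e + f).choose i : ℤ) * ((e + f - i).choose (e - i) : ℤ) := by exact_mod_cast h2
        have h3 : (-1 : ℤ) ^ (e - i) = (-1) ^ e * (-1) ^ i := by
          obtain ⟨c, rfl⟩ := Nat.exists_eq_add_of_le hi'
          rw [Nat.add_sub_cancel_left, pow_add]
          have : (-1 : ℤ) ^ i * (-1) ^ i = 1 := by rw [← mul_pow]; simp
          linear_combination (-(-1 : ℤ) ^ c) * this
        rw [h3]
        linear_combination (-(-1 : ℤ) ^ e * (-1) ^ i) * h2'
      rw [Finset.sum_congr rfl h1, ← Finset.mul_sum, Int.alternating_sum_range_choose]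
      by_cases he : e = 0
      · subst he; simp
      · simp [he]
    · intro i hi
      have hi' : ¬ r ≤ i := by simpa using hi
      simp [hi']
  · rw [if_neg (by omega)]
    apply Finset.sum_eq_zero
    intro i hi
    have : i < k + 1 := by simpa using hi
    have h3 : ¬ r ≤ i := by omega
    simp [h3]

lemma htr_choose (s : ℕ) : ∀ (k d : ℕ), k ≤ d →
    htr d (fun i => ((d + s).choose i : ℤ)) k = (Nat.multichoose s k : ℤ) := by
  induction s with
  | zero =>
    intro k d hk
    have := htr_unit d k 0 hk
    simp only [Nat.zero_le, if_true, Nat.sub_zero] at this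
    simp only [add_zero]
    rw [this]
    cases k <;> simp
  | succ s ih =>
    intro k
    induction k with
    | zero => intro d hk; simp [htr]
    | succ k ihk =>
      intro d hk
      obtain ⟨d, rfl⟩ : ∃ d', d = d' + 1 := ⟨d - 1, by omega⟩
      rw [Nat.multichoose_succ_succ]
      push_cast
      rw [← ih (k + 1) (d + 1) hk, ← ihk d (by omega)]
      unfold htr
      rw [Finset.sum_range_succ', Finset.sum_range_succ' _ (k + 1)]
      rw [add_right_comm _ _ (∑ i ∈ Finset.range (k + 1), (-1) ^ (k - i) * ((d - i).choose (k - i) : ℤ) * _), ← Finset.sum_add_distrib]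
      congr 1
      · apply Finset.sum_congr rfl
        intro i hi
        have : (d + 1 + (s + 1)).choose (i + 1)
            = (d + 1 + s).choose (i + 1) + (d + (s + 1)).choose i := by
          rw [show d + 1 + (s + 1) = (d + 1 + s) + 1 by ring, Nat.choose_succ_succ,
            show d + (s + 1) = d + 1 + s by ring, add_comm]
        beta_reduce
        rw [this]
        rw [Nat.add_sub_add_right, Nat.add_sub_add_right]
        push_cast; ring
      · simp

lemma card_interval (S R : Finset ℕ) (h : R ⊆ S) (i : ℕ) :
    ((S.powersetCard i).filter (fun Z => R ⊆ Z)).card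
      = if R.card ≤ i then (S.card - R.card).choose (i - R.card) else 0 := by
  split_ifs with hi
  · rw [← card_sdiff_of_subset h, ← card_powersetCard]
    refine card_bij' (fun Z _ => Z \ R) (fun Z _ => Z ∪ R) ?_ ?_ ?_ ?_
    · intro Z hZ
      simp only [mem_filter, mem_powersetCard] at hZ ⊢
      exact ⟨sdiff_subset_sdiff hZ.1.1 subset_rfl, by rw [card_sdiff_of_subset hZ.2, hZ.1.2]⟩
    · intro Z hZ
      simp only [mem_filter, mem_powersetCard] at hZ ⊢
      refine ⟨⟨union_subset (hZ.1.trans sdiff_subset) h, ?_⟩, subset_union_right⟩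
      rw [card_union_of_disjoint, hZ.2]
      · omega
      · exact disjoint_of_subset_left hZ.1 sdiff_disjoint
    · intro Z hZ
      simp only [mem_filter, mem_powersetCard] at hZ
      exact sdiff_union_of_subset hZ.2
    · intro Z hZ
      simp only [mem_powersetCard] at hZ
      rw [union_sdiff_right]
      exact sdiff_eq_self_of_disjoint (disjoint_of_subset_left hZ.1 sdiff_disjoint)
  · rw [card_eq_zero, filter_eq_empty_iff]
    intro Z hZ hR
    rw [mem_powersetCard] at hZ
    have := card_le_card hR
    omega

lemma htr_partition (d : ℕ) (C : Finset (Finset ℕ)) (ρ : Finset ℕ → Finset ℕ)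
    (hcard : ∀ S ∈ C, S.card = d) (hρ : ∀ S ∈ C, ρ S ⊆ S)
    (hex : ∀ Z : Finset ℕ, (∃ S ∈ C, Z ⊆ S) → ∃ S ∈ C, ρ S ⊆ Z ∧ Z ⊆ S)
    (huniq : ∀ Z : Finset ℕ, ∀ S ∈ C, ∀ T ∈ C, ρ S ⊆ Z → Z ⊆ S → ρ T ⊆ Z → Z ⊆ T → S = T)
    (f : ℕ → ℤ) (k : ℕ) (hk : k ≤ d)
    (hf : ∀ i, i ≤ k → f i = ((C.biUnion (fun S => S.powersetCard i)).card : ℤ)) :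
    htr d f k = ((C.filter (fun S => (ρ S).card = k)).card : ℤ) := by
  classical
  have h1 : ∀ i, i ≤ k → f i = ∑ S ∈ C,
      (if (ρ S).card ≤ i then ((d - (ρ S).card).choose (i - (ρ S).card) : ℤ) else 0) := by
    intro i hi
    rw [hf i hi]
    have : C.biUnion (fun S => S.powersetCard i)
        = C.biUnion (fun S => (S.powersetCard i).filter (fun Z => ρ S ⊆ Z)) := by
      ext Z
      simp only [mem_biUnion, mem_filter, mem_powersetCard]
      constructor
      · rintro ⟨S, hS, hZS, hc⟩
        obtain ⟨T, hT, h1, h2⟩ := hex Z ⟨S, hS, hZS⟩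
        exact ⟨T, hT, ⟨h2, hc⟩, h1⟩
      · rintro ⟨S, hS, h, -⟩
        exact ⟨S, hS, h⟩
    rw [this, card_biUnion]
    · push_cast
      apply Finset.sum_congr rfl
      intro S hS
      rw [card_interval S (ρ S) (hρ S hS), hcard S hS]
      split_ifs <;> simp
    · intro S hS T hT hne
      change Disjoint _ _
      rw [Finset.disjoint_left]
      intro Z h1 h2
      simp only [mem_filter, mem_powersetCard] at h1 h2
      exact hne (huniq Z S hS T hT h1.2 h1.1.1 h2.2 h2.1.1)
  have h2 : htr d f k = ∑ S ∈ C, htr d (fun i => if (ρ S).card ≤ i then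
      ((d - (ρ S).card).choose (i - (ρ S).card) : ℤ) else 0) k := by
    unfold htr
    rw [Finset.sum_comm]
    apply Finset.sum_congr rfl
    intro i hi
    rw [h1 i (by simpa [Nat.lt_succ_iff] using hi), Finset.mul_sum]
  rw [h2, Finset.sum_congr rfl (fun S _ => htr_unit d k _ hk)]
  simp

def ppt (d n s j : ℕ) : ℝ := acp d n s (acT d s j)

lemma acT_sub (d s i j : ℕ) : acT d s i - acT d s j = (i : ℝ) - j := by
  unfold acT; ring

lemma acT_inj (d s : ℕ) : Function.Injective (acT d s) := by
  intro i j h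
  have := acT_sub d s i j
  rw [h, sub_self] at this
  have h2 : (i : ℝ) = j := by linarith
  exact_mod_cast h2

lemma ppt_zero {d n s j : ℕ} (hj : j < d + s) : ppt d n s j = 0 := by
  unfold ppt acp
  apply mul_eq_zero_of_right
  apply Finset.prod_eq_zero (i := d + s - 1 - j)
  · simp; omega
  · unfold acT
    rw [Nat.cast_sub (by omega), Nat.cast_sub (by omega)]
    push_cast; ring

lemma acT_ge {d s j : ℕ} (hj : d + s ≤ j) : 1 ≤ acT d s j := by
  unfold acT
  have : ((d + s : ℕ) : ℝ) ≤ j := by exact_mod_cast hj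
  push_cast at this; linarith

lemma ppt_pos {d n s j : ℕ} (hn : 2 ≤ n) (hj : d + s ≤ j) : 0 < ppt d n s j := by
  unfold ppt acp
  have h1 := acT_ge hj
  have hn' : (2 : ℝ) ≤ n := by exact_mod_cast hn
  apply mul_pos
  · apply Real.rpow_pos_of_pos; linarith
  · apply Finset.prod_pos
    intro l _
    have : (0 : ℝ) ≤ l := Nat.cast_nonneg l
    linarith

lemma ppt_nonneg {d n s j : ℕ} (hn : 2 ≤ n) : 0 ≤ ppt d n s j := by
  by_cases h : j < d + s
  · rw [ppt_zero h]
  · exact (ppt_pos hn (by omega)).le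

lemma ppt_growth {d n s i j : ℕ} (hd : 1 ≤ d) (hn : 2 ≤ n) (hij : i < j) (hj : d + s ≤ j) :
    ((n : ℝ) - 1) ^ (d - 1) * ppt d n s i < ppt d n s j := by
  by_cases hi : i < d + s
  · rw [ppt_zero hi, mul_zero]; exact ppt_pos hn hj
  · have hi' : d + s ≤ i := by omega
    have h1 := acT_ge hi'
    have h2 : acT d s i + 1 ≤ acT d s j := by
      have := acT_sub d s j i
      have h3 : (i : ℝ) + 1 ≤ j := by exact_mod_cast hij
      linarith
    have hn' : (2 : ℝ) ≤ n := by exact_mod_cast hn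
    have hd' : (1 : ℝ) ≤ d := by exact_mod_cast hd
    unfold ppt acp
    rw [← mul_assoc]
    have hpw : ((n : ℝ) - 1) ^ (d - 1) * ((n : ℝ) - 1) ^ ((acT d s i - 1) * ((d : ℝ) - 1))
        ≤ ((n : ℝ) - 1) ^ ((acT d s j - 1) * ((d : ℝ) - 1)) := by
      rw [← Real.rpow_natCast, ← Real.rpow_add (by linarith)]
      apply Real.rpow_le_rpow_of_exponent_le (by linarith)
      rw [Nat.cast_sub hd]
      push_cast
      nlinarith
    have hpr : ∏ l ∈ Finset.range (d + s), (acT d s i + (l : ℝ))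
        < ∏ l ∈ Finset.range (d + s), (acT d s j + (l : ℝ)) := by
      apply Finset.prod_lt_prod_of_nonempty
      · intro l _
        have : (0 : ℝ) ≤ l := Nat.cast_nonneg l
        linarith
      · intro l _; linarith
      · exact ⟨0, by simp; omega⟩
    apply mul_lt_mul' hpw hpr
    · apply Finset.prod_nonneg
      intro l _
      have : (0 : ℝ) ≤ l := Nat.cast_nonneg l
      linarith
    · apply Real.rpow_pos_of_pos; linarith

lemma sign_prod (S : Finset ℕ) (y : ℕ) (hy : y ∉ S) :
    (-1 : ℝ) ^ upc S y * ∏ j ∈ S, ((y : ℝ) - j) = ∏ j ∈ S, |(y : ℝ) - j| := by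
  classical
  induction S using Finset.induction_on with
  | empty => simp [upc]
  | insert a S ha ih =>
    simp only [mem_insert, not_or] at hy
    rw [prod_insert ha, prod_insert ha, ← ih hy.2]
    unfold upc
    rw [filter_insert]
    split_ifs with h
    · rw [card_insert_of_notMem (by simp [ha]), pow_succ]
      have : (y : ℝ) < a := by exact_mod_cast h
      rw [abs_of_neg (by linarith)]; ring
    · have : (a : ℝ) ≤ y := by exact_mod_cast (not_lt.1 h)
      rw [abs_of_nonneg (by linarith)]; ring

lemma alt_sum (a : ℕ → ℝ) (T : Finset ℕ) : (∀ i ∈ T, 0 ≤ a i) →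
    (∀ i ∈ T, ∀ j ∈ T, i < j → a i ≤ a j) → ∀ B : ℝ, 0 ≤ B → (∀ i ∈ T, a i ≤ B) →
    0 ≤ ∑ i ∈ T, (-1 : ℝ) ^ upc T i * a i ∧ ∑ i ∈ T, (-1 : ℝ) ^ upc T i * a i ≤ B := by
  classical
  induction T using Finset.induction_on_max with
  | empty => intro _ _ B hB _; simp [hB]
  | insert M T hM ih =>
    intro h0 hm B hB hle
    have hMT : M ∉ T := fun h => lt_irrefl _ (hM M h)
    have e1 : ∑ i ∈ insert M T, (-1 : ℝ) ^ upc (insert M T) i * a i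
        = a M - ∑ i ∈ T, (-1 : ℝ) ^ upc T i * a i := by
      rw [sum_insert hMT]
      have : upc (insert M T) M = 0 := by
        unfold upc
        rw [card_eq_zero, filter_eq_empty_iff]
        intro x hx
        rcases mem_insert.1 hx with rfl | hx
        · omega
        · have := hM x hx; omega
      rw [this, pow_zero, one_mul, sub_eq_add_neg, ← sum_neg_distrib]
      congr 1
      apply sum_congr rfl
      intro i hi
      have : upc (insert M T) i = upc T i + 1 := by
        unfold upc
        rw [filter_insert, if_pos (hM i hi), card_insert_of_notMem (by simp [hMT])]
      rw [this, pow_succ]; ring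
    rw [e1]
    have := ih (fun i hi => h0 i (mem_insert_of_mem hi))
      (fun i hi j hj => hm i (mem_insert_of_mem hi) j (mem_insert_of_mem hj))
      (a M) (h0 M (mem_insert_self _ _))
      (fun i hi => hm i (mem_insert_of_mem hi) M (mem_insert_self _ _) (hM i hi))
    have h4 := hle M (mem_insert_self _ _)
    constructor <;> linarith [this.1, this.2]

lemma alt_sum_pos (a : ℕ → ℝ) (T : Finset ℕ) (h0 : ∀ i ∈ T, 0 ≤ a i)
    (hm : ∀ i ∈ T, ∀ j ∈ T, i < j → a i ≤ a j) (M : ℕ) (hMT : M ∈ T)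
    (hM : ∀ i ∈ T, i ≠ M → i < M ∧ a i < a M) (hMpos : 0 < a M) :
    0 < ∑ i ∈ T, (-1 : ℝ) ^ upc T i * a i := by
  classical
  have hpos : ∃ B, 0 ≤ B ∧ B < a M ∧ ∀ i ∈ T.erase M, a i ≤ B := by
    rcases (T.erase M).eq_empty_or_nonempty with h | h
    · exact ⟨0, le_rfl, hMpos, by simp [h]⟩
    · obtain ⟨x, hx, hmax⟩ := Finset.exists_max_image (T.erase M) a h
      have hx' := mem_erase.1 hx
      exact ⟨a x, h0 x hx'.2, (hM x hx'.2 hx'.1).2, hmax⟩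
  obtain ⟨B, hB0, hBM, hB⟩ := hpos
  have := alt_sum a (T.erase M) (fun i hi => h0 i (mem_of_mem_erase hi))
    (fun i hi j hj => hm i (mem_of_mem_erase hi) j (mem_of_mem_erase hj)) B hB0 hB
  rw [← Finset.add_sum_erase T _ hMT]
  have e1 : upc T M = 0 := by
    unfold upc
    rw [card_eq_zero, filter_eq_empty_iff]
    intro x hx
    by_cases h : x = M
    · omega
    · have := (hM x hx h).1; omega
  have e2 : ∑ i ∈ T.erase M, (-1 : ℝ) ^ upc T i * a i
      = - ∑ i ∈ T.erase M, (-1 : ℝ) ^ upc (T.erase M) i * a i := by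
    rw [← sum_neg_distrib]
    apply sum_congr rfl
    intro i hi
    have hi' := mem_erase.1 hi
    have : upc T i = upc (T.erase M) i + 1 := by
      unfold upc
      rw [filter_erase, card_erase_add_one]
      simp [hMT, (hM i hi'.2 hi'.1).1]
    rw [this, pow_succ]; ring
  rw [e1, e2]
  linarith [this.2]

lemma weight_cmp {d n : ℕ} {T : Finset ℕ} (hT : T ⊆ Finset.range n) (hc : T.card = d + 1)
    {i j : ℕ} (hi : i ∈ T) (hj : j ∈ T) (hij : i ≠ j) :
    ∏ x ∈ T.erase j, |(j : ℝ) - x| ≤ ((n : ℝ) - 1) ^ (d - 1) * ∏ x ∈ T.erase i, |(i : ℝ) - x| := by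
  classical
  have hi' : i ∈ T.erase j := mem_erase.2 ⟨hij, hi⟩
  have hj' : j ∈ T.erase i := mem_erase.2 ⟨hij.symm, hj⟩
  rw [← Finset.mul_prod_erase _ _ hi', ← Finset.mul_prod_erase _ _ hj', erase_right_comm,
    abs_sub_comm (j : ℝ) i]
  have hcard : ((T.erase i).erase j).card = d - 1 := by
    rw [card_erase_of_mem hj', card_erase_of_mem hi]; omega
  have : ∏ x ∈ (T.erase i).erase j, |(j : ℝ) - x|
      ≤ ∏ x ∈ (T.erase i).erase j, (((n : ℝ) - 1) * |(i : ℝ) - x|) := by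
    apply prod_le_prod
    · intro x _; positivity
    · intro x hx
      simp only [mem_erase] at hx
      have hxn : x < n := by simpa using hT hx.2.2
      have hjn : j < n := by simpa using hT hj
      have hxn' : (x : ℝ) + 1 ≤ n := by exact_mod_cast hxn
      have hjn' : (j : ℝ) + 1 ≤ n := by exact_mod_cast hjn
      have h0x : (0 : ℝ) ≤ x := Nat.cast_nonneg x
      have h0j : (0 : ℝ) ≤ j := Nat.cast_nonneg j
      have h1 : |(j : ℝ) - x| ≤ n - 1 := by rw [abs_le]; constructor <;> linarith
      have h2 : (1 : ℝ) ≤ |(i : ℝ) - x| := by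
        have h3 : ((i : ℤ) - x) ≠ 0 := by
          have := hx.2.1; omega
        have := Int.one_le_abs h3
        have h4 : ((1 : ℤ) : ℝ) ≤ ((|(i : ℤ) - x| : ℤ) : ℝ) := by exact_mod_cast this
        push_cast at h4; exact h4
      nlinarith
  rw [prod_mul_distrib, prod_const, hcard] at this
  calc _ ≤ |(i : ℝ) - j| * (((n : ℝ) - 1) ^ (d - 1) * ∏ x ∈ (T.erase i).erase j, |(i : ℝ) - x|) :=
        mul_le_mul_of_nonneg_left this (abs_nonneg _)
    _ = _ := by ring

/-- positivity of the divided differences -/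
lemma dd_pos {d n s : ℕ} (hd : 1 ≤ d) (hn : 2 ≤ n) {T : Finset ℕ} (hT : T ⊆ Finset.range n)
    (hc : T.card = d + 1) (hTm : ¬ T ⊆ Finset.range (d + s)) :
    0 < ∑ i ∈ T, (∏ x ∈ T.erase i, ((i : ℝ) - x)⁻¹) * ppt d n s i := by
  classical
  set a : ℕ → ℝ := fun i => (∏ x ∈ T.erase i, |(i : ℝ) - x|)⁻¹ * ppt d n s i with ha
  have hprodpos : ∀ i, 0 < ∏ x ∈ T.erase i, |(i : ℝ) - x| := by
    intro i
    apply prod_pos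
    intro x hx
    rw [abs_pos, sub_ne_zero]
    have := (mem_erase.1 hx).1
    exact_mod_cast this.symm
  have h1 : ∑ i ∈ T, (∏ x ∈ T.erase i, ((i : ℝ) - x)⁻¹) * ppt d n s i
      = ∑ i ∈ T, (-1 : ℝ) ^ upc T i * a i := by
    apply sum_congr rfl
    intro i hi
    have h2 := sign_prod (T.erase i) i (by simp)
    have h3 : upc (T.erase i) i = upc T i := by
      unfold upc; rw [filter_erase, erase_eq_of_notMem]; simp
    rw [h3] at h2
    simp only [ha]
    rw [prod_inv_distrib, ← h2, mul_inv]
    have h4 : (-1 : ℝ) ^ upc T i * ((-1 : ℝ) ^ upc T i)⁻¹ = 1 := mul_inv_cancel₀ (by positivity)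
    linear_combination (-(∏ x ∈ T.erase i, ((i : ℝ) - x))⁻¹ * ppt d n s i) * h4
  rw [h1]
  have hn1 : (0 : ℝ) < (n : ℝ) - 1 := by
    have : (2 : ℝ) ≤ n := by exact_mod_cast hn
    linarith
  have hlt : ∀ i ∈ T, ∀ j ∈ T, i < j → d + s ≤ j → a i < a j := by
    intro i hi j hj hij hjm
    have h2 := weight_cmp hT hc hi hj hij.ne
    have h3 := ppt_growth hd hn hij hjm
    simp only [ha]
    rw [inv_mul_lt_iff₀ (hprodpos i)]
    have h5 : 0 < ppt d n s j := ppt_pos hn hjm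
    have h6 := ppt_nonneg (d := d) (s := s) (j := i) hn
    have h7 := hprodpos i
    have h8 := hprodpos j
    have h9 : (∏ x ∈ T.erase j, |(j : ℝ) - x|) * ppt d n s i <
      (∏ x ∈ T.erase i, |(i : ℝ) - x|) * ppt d n s j := by
      calc _ ≤ (((n : ℝ) - 1) ^ (d - 1) * ∏ x ∈ T.erase i, |(i : ℝ) - x|) * ppt d n s i :=
            mul_le_mul_of_nonneg_right h2 h6
        _ = (∏ x ∈ T.erase i, |(i : ℝ) - x|) * (((n : ℝ) - 1) ^ (d - 1) * ppt d n s i) := by ring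
        _ < _ := mul_lt_mul_of_pos_left h3 h7
    have h10 : ppt d n s i < (∏ x ∈ T.erase j, |(j : ℝ) - x|)⁻¹ *
        ((∏ x ∈ T.erase i, |(i : ℝ) - x|) * ppt d n s j) := by
      rw [lt_inv_mul_iff₀ h8]; exact h9
    calc ppt d n s i < _ := h10
      _ = _ := by ring
  have h0 : ∀ i ∈ T, 0 ≤ a i := fun i _ =>
    mul_nonneg (inv_nonneg.2 (hprodpos i).le) (ppt_nonneg hn)
  obtain ⟨M, hMT, hmax⟩ := Finset.exists_max_image T id (card_pos.1 (by omega))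
  have hMm : d + s ≤ M := by
    by_contra hcon
    apply hTm
    intro x hx
    have := hmax x hx
    simp only [id] at this
    simp; omega
  apply alt_sum_pos a T h0 _ M hMT
  · intro i hi hne
    have := hmax i hi
    simp only [id] at this
    have h3 : i < M := by omega
    exact ⟨h3, hlt i hi M hMT h3 hMm⟩
  · exact mul_pos (inv_pos.2 (hprodpos M)) (ppt_pos hn hMm)
  · intro i hi j hj hij
    by_cases hjm : d + s ≤ j
    · exact (hlt i hi j hj hij hjm).le
    · have : a i = 0 := by simp only [ha]; rw [ppt_zero (by omega), mul_zero]
      rw [this]; exact h0 j hj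

/-- the functional vanishing on `S` -/
def fS (d n s : ℕ) (S : Finset ℕ) (y : ℕ) : ℝ :=
  ppt d n s y - (Lagrange.interpolate S (acT d s) (ppt d n s)).eval (acT d s y)

lemma fS_zero (d n s : ℕ) (S : Finset ℕ) {y : ℕ} (hy : y ∈ S) : fS d n s S y = 0 := by
  unfold fS
  rw [Lagrange.eval_interpolate_at_node _ (acT_inj d s).injOn hy, sub_self]

lemma fS_sign {d n s : ℕ} (hd : 1 ≤ d) (hn : 2 ≤ n) {S : Finset ℕ} (hS : S ⊆ Finset.range n)
    (hc : S.card = d) {y : ℕ} (hyn : y < n) (hy : y ∉ S)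
    (hSm : ¬ insert y S ⊆ Finset.range (d + s)) :
    0 < (-1 : ℝ) ^ upc S y * fS d n s S y := by
  classical
  have hdd := dd_pos (s := s) hd hn (T := insert y S) (by
    intro x hx
    rcases mem_insert.1 hx with rfl | hx
    · simpa using hyn
    · exact hS hx) (by rw [card_insert_of_notMem hy, hc]) hSm
  have hne : ∀ i ∈ S, acT d s y ≠ acT d s i := by
    intro i hi h
    have := acT_inj d s h
    subst this; exact hy hi
  have key : fS d n s S y = (∏ j ∈ S, ((y : ℝ) - j)) *
      ∑ i ∈ insert y S, (∏ x ∈ (insert y S).erase i, ((i : ℝ) - x)⁻¹) * ppt d n s i := by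
    unfold fS
    rw [Lagrange.eval_interpolate_not_at_node _ hne, Lagrange.eval_nodal, sum_insert hy,
      erase_insert hy]
    simp only [acT_sub]
    have hp : ∏ j ∈ S, ((y : ℝ) - j) ≠ 0 := by
      rw [prod_ne_zero_iff]
      intro j hj
      rw [sub_ne_zero]
      have : y ≠ j := by rintro rfl; exact hy hj
      exact_mod_cast this
    rw [mul_add, ← mul_assoc, prod_inv_distrib, mul_inv_cancel₀ hp, one_mul, sub_eq_add_neg,
      ← mul_neg, ← sum_neg_distrib]
    congr 2
    apply sum_congr rfl
    intro i hi
    have hyi : y ≠ i := by rintro rfl; exact hy hi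
    rw [erase_insert_of_ne hyi, prod_insert (by simp [hy]), Lagrange.nodalWeight]
    simp only [acT_sub]
    rw [← neg_sub (i : ℝ) (y : ℝ), inv_neg]
    ring
  rw [key, ← mul_assoc, sign_prod S y hy]
  apply mul_pos _ hdd
  apply prod_pos
  intro x hx
  rw [abs_pos, sub_ne_zero]
  have : y ≠ x := by rintro rfl; exact hy hx
  exact_mod_cast this

def Yp (d n s j : ℕ) : Fin d → ℝ := acy d n s (acT d s j)

def cv (d n s : ℕ) (Z : Finset ℕ) : Set (Fin d → ℝ) :=
  convexHull ℝ (Yp d n s '' (Z : Set ℕ))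

def IsFn (d n s : ℕ) (u : ℕ → ℝ) : Prop :=
  ∃ (b : Fin d → ℝ) (c : ℝ), ∀ j, u j = c - dotp b (Yp d n s j)

lemma dotp_add_left {d : ℕ} (a b x : Fin d → ℝ) : dotp (a + b) x = dotp a x + dotp b x := by
  unfold dotp; rw [← sum_add_distrib]; apply sum_congr rfl; intro i _; simp [add_mul]

lemma dotp_smul_left {d : ℕ} (r : ℝ) (b x : Fin d → ℝ) : dotp (r • b) x = r * dotp b x := by
  unfold dotp; rw [mul_sum]; apply sum_congr rfl; intro i _; simp [mul_assoc]

def dotL {d : ℕ} (b : Fin d → ℝ) : (Fin d → ℝ) →ₗ[ℝ] ℝ where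
  toFun x := dotp b x
  map_add' x y := by
    unfold dotp; rw [← sum_add_distrib]; apply sum_congr rfl; intro i _; simp [mul_add]
  map_smul' r x := by
    unfold dotp; simp only [RingHom.id_apply, smul_eq_mul]; rw [mul_sum]
    apply sum_congr rfl; intro i _; simp; ring

lemma dotL_apply {d : ℕ} (b x : Fin d → ℝ) : dotL b x = dotp b x := rfl

lemma isFn_add {d n s : ℕ} {u v : ℕ → ℝ} (hu : IsFn d n s u) (hv : IsFn d n s v) :
    IsFn d n s (fun j => u j + v j) := by
  obtain ⟨b, c, h⟩ := hu
  obtain ⟨b', c', h'⟩ := hv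
  refine ⟨b + b', c + c', fun j => ?_⟩
  beta_reduce
  rw [dotp_add_left, h, h']; ring

lemma isFn_smul {d n s : ℕ} {u : ℕ → ℝ} (hu : IsFn d n s u) (r : ℝ) :
    IsFn d n s (fun j => r * u j) := by
  obtain ⟨b, c, h⟩ := hu
  refine ⟨r • b, r * c, fun j => ?_⟩
  beta_reduce
  rw [dotp_smul_left, h]; ring

lemma dotp_Y (e n s j : ℕ) (b : Fin (e + 1) → ℝ) :
    dotp b (Yp (e + 1) n s j) = ∑ i : Fin e, b i.castSucc * (acT (e + 1) s j) ^ ((i : ℕ) + 1)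
      + b (Fin.last e) * ppt (e + 1) n s j := by
  unfold dotp
  rw [Fin.sum_univ_castSucc]
  congr 1
  · apply sum_congr rfl
    intro i _
    unfold Yp acy
    have := i.2
    rw [if_neg (by simp; omega)]
    simp
  · unfold Yp acy ppt
    simp

lemma isFn_ppt (d n s : ℕ) (hd : 1 ≤ d) : IsFn d n s (ppt d n s) := by
  obtain ⟨e, rfl⟩ : ∃ e, d = e + 1 := ⟨d - 1, by omega⟩
  refine ⟨fun i => if i = Fin.last e then -1 else 0, 0, fun j => ?_⟩
  rw [dotp_Y]
  simp [Fin.castSucc_ne_last]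

lemma isFn_poly (d n s : ℕ) (hd : 1 ≤ d) (q : Polynomial ℝ) (hq : q.degree < d) :
    IsFn d n s (fun j => q.eval (acT d s j)) := by
  obtain ⟨e, rfl⟩ : ∃ e, d = e + 1 := ⟨d - 1, by omega⟩
  refine ⟨fun i => if i = Fin.last e then 0 else - q.coeff ((i : ℕ) + 1), q.coeff 0, fun j => ?_⟩
  beta_reduce
  rw [dotp_Y, Polynomial.eval_eq_sum_range' (n := e + 1), sum_range_succ']
  · simp [Fin.castSucc_ne_last]
    rw [Finset.sum_range (fun i => q.coeff (i + 1) * acT (e + 1) s j ^ (i + 1))]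
    ring
  · by_cases h : q = 0
    · simp [h]
    · exact (Polynomial.natDegree_lt_iff_degree_lt h).2 hq

lemma isFn_repr {d n s : ℕ} (hd : 1 ≤ d) {u : ℕ → ℝ} (hu : IsFn d n s u) :
    ∃ (q : Polynomial ℝ) (γ : ℝ), q.degree < d ∧
      ∀ j, u j = q.eval (acT d s j) + γ * ppt d n s j := by
  obtain ⟨e, rfl⟩ : ∃ e, d = e + 1 := ⟨d - 1, by omega⟩
  obtain ⟨b, c, h⟩ := hu
  refine ⟨∑ i : Fin (e + 1), Polynomial.C ((Fin.cons c (fun i => - b i.castSucc) :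
    Fin (e + 1) → ℝ) i) * Polynomial.X ^ (i : ℕ), - b (Fin.last e),
    Polynomial.degree_sum_fin_lt _, fun j => ?_⟩
  rw [h, dotp_Y, Fin.sum_univ_succ]
  simp [Polynomial.eval_finsetSum]
  ring

lemma isFn_fS (d n s : ℕ) (hd : 1 ≤ d) (S : Finset ℕ) (hS : S.card = d) :
    IsFn d n s (fS d n s S) := by
  have h1 := isFn_poly d n s hd (Lagrange.interpolate S (acT d s) (ppt d n s)) (by
    have := Lagrange.degree_interpolate_lt (s := S) (v := acT d s) (ppt d n s) (acT_inj d s).injOn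
    rwa [hS] at this)
  have h2 := isFn_add (isFn_ppt d n s hd) (isFn_smul h1 (-1))
  convert h2 using 2
  unfold fS; ring

lemma isFn_lag (d n s : ℕ) (hd : 1 ≤ d) (S : Finset ℕ) (hS : S.card ≤ d) (r : ℕ → ℝ) :
    ∃ g, IsFn d n s g ∧ ∀ j ∈ S, g j = r j := by
  refine ⟨_, isFn_poly d n s hd (Lagrange.interpolate S (acT d s) r) ?_, ?_⟩
  · have := Lagrange.degree_interpolate_lt (s := S) (v := acT d s) r (acT_inj d s).injOn
    exact this.trans_le (by exact_mod_cast hS)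
  · intro j hj
    exact Lagrange.eval_interpolate_at_node _ (acT_inj d s).injOn hj

lemma isFn_eq_fS {d n s : ℕ} (hd : 1 ≤ d) {S : Finset ℕ} (hS : S.card = d) {u : ℕ → ℝ}
    (hu : IsFn d n s u) (h0 : ∀ j ∈ S, u j = 0) : ∃ γ : ℝ, ∀ j, u j = γ * fS d n s S j := by
  obtain ⟨q, γ, hq, h⟩ := isFn_repr hd hu
  refine ⟨γ, ?_⟩
  have hz : q + Polynomial.C γ * Lagrange.interpolate S (acT d s) (ppt d n s) = 0 := by
    apply Polynomial.eq_zero_of_degree_lt_of_eval_index_eq_zero S (v := acT d s)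
      (acT_inj d s).injOn
    · have h1 := Lagrange.degree_interpolate_lt (s := S) (v := acT d s) (ppt d n s)
        (acT_inj d s).injOn
      apply (Polynomial.degree_add_le _ _).trans_lt
      rw [max_lt_iff]
      refine ⟨by rwa [hS], ?_⟩
      by_cases hγ : γ = 0
      · simp [hγ]
      · rwa [Polynomial.degree_C_mul hγ]
    · intro i hi
      have h2 := h i
      rw [h0 i hi] at h2
      rw [Polynomial.eval_add, Polynomial.eval_mul, Polynomial.eval_C,
        Lagrange.eval_interpolate_at_node _ (acT_inj d s).injOn hi]
      linarith
  intro j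
  have h3 := congrArg (Polynomial.eval (acT d s j)) hz
  rw [Polynomial.eval_add, Polynomial.eval_mul, Polynomial.eval_C, Polynomial.eval_zero] at h3
  rw [h]; unfold fS; linarith

lemma Yp_inj (d n s : ℕ) (hd : 2 ≤ d) : Function.Injective (Yp d n s) := by
  intro i j h
  have := congrFun h ⟨0, by omega⟩
  simp only [Yp, acy] at this
  rw [if_neg (by omega), if_neg (by omega)] at this
  apply acT_inj d s
  simpa using this

lemma mem_cv {d n s : ℕ} (hd : 2 ≤ d) (T : Finset ℕ) (x : Fin d → ℝ) :
    x ∈ cv d n s T ↔ ∃ w : ℕ → ℝ, (∀ j ∈ T, 0 ≤ w j) ∧ ∑ j ∈ T, w j = 1 ∧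
      ∑ j ∈ T, w j • Yp d n s j = x := by
  classical
  unfold cv
  constructor
  · intro h
    rw [← Finset.coe_image, Finset.mem_convexHull'] at h
    obtain ⟨w, h0, h1, h2⟩ := h
    refine ⟨fun j => w (Yp d n s j), fun j hj => h0 _ (mem_image_of_mem _ hj), ?_, ?_⟩
    · rw [sum_image (Yp_inj d n s hd).injOn] at h1; exact h1
    · rw [sum_image (Yp_inj d n s hd).injOn] at h2; exact h2
  · rintro ⟨w, h0, h1, rfl⟩
    apply (convex_convexHull ℝ _).sum_mem h0 h1
    intro i hi
    exact subset_convexHull ℝ _ ⟨i, hi, rfl⟩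

lemma acPolytope_eq (d n s : ℕ) : acPolytope d n s = cv d n s (Finset.range n) := by
  unfold acPolytope cv
  congr 1
  ext x
  constructor
  · rintro ⟨j, rfl⟩
    exact ⟨j, by simp, rfl⟩
  · rintro ⟨j, hj, rfl⟩
    exact ⟨⟨j, by simpa using hj⟩, rfl⟩

lemma Yp_mem_cv {d n s : ℕ} {T : Finset ℕ} {j : ℕ} (hj : j ∈ T) : Yp d n s j ∈ cv d n s T :=
  subset_convexHull ℝ _ ⟨j, hj, rfl⟩

lemma cv_mono {d n s : ℕ} {T U : Finset ℕ} (h : T ⊆ U) : cv d n s T ⊆ cv d n s U :=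
  convexHull_mono (Set.image_mono (by exact_mod_cast h))

/-- evaluation of a functional on a combination -/
lemma fn_comb {d n s : ℕ} {u : ℕ → ℝ} {b : Fin d → ℝ} {c : ℝ}
    (h : ∀ j, u j = c - dotp b (Yp d n s j)) (T : Finset ℕ) (w : ℕ → ℝ) :
    ∑ j ∈ T, w j * u j = c * (∑ j ∈ T, w j) - dotp b (∑ j ∈ T, w j • Yp d n s j) := by
  rw [← dotL_apply, map_sum, mul_sum, ← sum_sub_distrib]
  apply sum_congr rfl
  intro j _
  rw [map_smul, dotL_apply, h, smul_eq_mul]; ring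

lemma face_eq {d n s : ℕ} (hd : 2 ≤ d) {u : ℕ → ℝ} {b : Fin d → ℝ} {c : ℝ}
    (h : ∀ j, u j = c - dotp b (Yp d n s j)) (hu : ∀ j < n, 0 ≤ u j) (Z : Finset ℕ)
    (hZ : ∀ j, j ∈ Z ↔ j < n ∧ u j = 0) :
    (∀ x ∈ cv d n s (range n), dotp b x ≤ c) ∧
    {x ∈ cv d n s (range n) | dotp b x = c} = cv d n s Z := by
  have hZn : Z ⊆ range n := fun j hj => by simpa using ((hZ j).1 hj).1
  constructor
  · intro x hx
    obtain ⟨w, h0, h1, rfl⟩ := (mem_cv hd _ _).1 hx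
    have h2 := fn_comb h (range n) w
    rw [h1] at h2
    have h3 : 0 ≤ ∑ j ∈ range n, w j * u j :=
      sum_nonneg (fun j hj => mul_nonneg (h0 j hj) (hu j (by simpa using hj)))
    linarith
  · ext x
    constructor
    · rintro ⟨hx, hxc⟩
      obtain ⟨w, h0, h1, rfl⟩ := (mem_cv hd _ _).1 hx
      have h2 := fn_comb h (range n) w
      rw [h1, hxc, mul_one, sub_self] at h2
      rw [sum_eq_zero_iff_of_nonneg
        (fun j hj => mul_nonneg (h0 j hj) (hu j (by simpa using hj)))] at h2
      have h3 : ∀ j ∈ range n, j ∉ Z → w j = 0 := by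
        intro j hj hjZ
        rcases mul_eq_zero.1 (h2 j hj) with h4 | h4
        · exact h4
        · exact absurd ((hZ j).2 ⟨by simpa using hj, h4⟩) hjZ
      rw [mem_cv hd]
      refine ⟨w, fun j hj => h0 j (hZn hj), ?_, ?_⟩
      · rw [← h1]; exact sum_subset hZn h3
      · apply sum_subset hZn
        intro j hj hjZ
        rw [h3 j hj hjZ, zero_smul]
    · intro hx
      refine ⟨cv_mono hZn hx, ?_⟩
      obtain ⟨w, h0, h1, rfl⟩ := (mem_cv hd _ _).1 hx
      have h2 := fn_comb h Z w
      rw [h1, sum_eq_zero (fun j hj => by rw [((hZ j).1 hj).2, mul_zero])] at h2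
      linarith

lemma mem_of_Yp_mem {d n s : ℕ} (hd : 2 ≤ d) {u : ℕ → ℝ} (h : IsFn d n s u)
    (hu : ∀ j < n, 0 ≤ u j) (Z : Finset ℕ)
    (hZ : ∀ j, j ∈ Z ↔ j < n ∧ u j = 0) {j : ℕ} (hj : j < n) (hY : Yp d n s j ∈ cv d n s Z) :
    j ∈ Z := by
  obtain ⟨b, c, h⟩ := h
  rw [← (face_eq hd h hu Z hZ).2] at hY
  exact (hZ j).2 ⟨hj, by rw [h, hY.2, sub_self]⟩

lemma affInd_of {d n s : ℕ} (T : Finset ℕ)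
    (h : ∀ i ∈ T, ∃ u, IsFn d n s u ∧ u i ≠ 0 ∧ ∀ j ∈ T, j ≠ i → u j = 0) :
    AffineIndependent ℝ (fun j : T => Yp d n s j) := by
  rw [affineIndependent_iff]
  intro t w h0 h1 e he
  obtain ⟨u, ⟨b, c, hu⟩, hne, hz⟩ := h e e.2
  have h2 : ∑ j ∈ t, w j * u j = c * (∑ j ∈ t, w j) - dotp b (∑ j ∈ t, w j • Yp d n s j) := by
    rw [← dotL_apply, map_sum, mul_sum, ← sum_sub_distrib]
    apply sum_congr rfl
    intro j _
    rw [map_smul, dotL_apply, hu, smul_eq_mul]; ring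
  rw [h0, h1, ← dotL_apply, map_zero, mul_zero, sub_zero, sum_eq_single e] at h2
  · rcases mul_eq_zero.1 h2 with h3 | h3
    · exact h3
    · exact absurd h3 hne
  · intro j _ hj
    rw [hz j j.2 (fun h => hj (Subtype.ext h)), mul_zero]
  · intro h; exact absurd he h

lemma polyDim_cv_eq (d n s : ℕ) (T : Finset ℕ) :
    polyDim (cv d n s T) = Module.finrank ℝ (vectorSpan ℝ (Yp d n s '' (T : Set ℕ))) := by
  unfold polyDim cv
  rw [affineSpan_convexHull, direction_affineSpan]

lemma polyDim_of_affInd {d n s : ℕ} (T : Finset ℕ)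
    (h : AffineIndependent ℝ (fun j : T => Yp d n s j)) (hT : T.Nonempty) :
    polyDim (cv d n s T) = T.card - 1 := by
  rw [polyDim_cv_eq]
  have h1 : Yp d n s '' (T : Set ℕ) = Set.range (fun j : T => Yp d n s j) := by
    ext x; simp
  rw [h1]
  apply h.finrank_vectorSpan
  have := card_pos.2 hT
  simp; omega

lemma polyDim_small {d n s : ℕ} (hd : 1 ≤ d) (T : Finset ℕ) (hT : T.Nonempty) (hc : T.card ≤ d) :
    polyDim (cv d n s T) = T.card - 1 := by
  apply polyDim_of_affInd T _ hT
  apply affInd_of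
  intro i hi
  obtain ⟨g, hg, h⟩ := isFn_lag d n s hd T hc (fun j => if j = i then 1 else 0)
  refine ⟨g, hg, by rw [h i hi]; simp, fun j hj hji => by rw [h j hj]; simp [hji]⟩

lemma polyDim_cv_mono {d n s : ℕ} {T U : Finset ℕ} (h : T ⊆ U) :
    polyDim (cv d n s T) ≤ polyDim (cv d n s U) := by
  rw [polyDim_cv_eq, polyDim_cv_eq]
  apply Submodule.finrank_mono
  apply vectorSpan_mono
  exact Set.image_mono (by exact_mod_cast h)

lemma fS_ne {d n s : ℕ} (hd : 1 ≤ d) (hn : 2 ≤ n) {S : Finset ℕ} (hS : S ⊆ Finset.range n)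
    (hc : S.card = d) {y : ℕ} (hyn : y < n) (hy : y ∉ S)
    (hSm : ¬ insert y S ⊆ Finset.range (d + s)) : fS d n s S y ≠ 0 := by
  intro h
  have := fS_sign hd hn hS hc hyn hy hSm
  rw [h, mul_zero] at this
  exact lt_irrefl _ this

lemma polyDim_P {d n s : ℕ} (hd : 2 ≤ d) (hn : d + s < n) :
    polyDim (cv d n s (range n)) = d := by
  apply le_antisymm
  · unfold polyDim
    refine (Submodule.finrank_le _).trans ?_
    simp
  · have hni : n - 1 ∉ range d := by simp; omega
    have hsub : insert (n - 1) (range d) ⊆ range n := by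
      intro x hx
      rcases mem_insert.1 hx with rfl | hx
      · simp; omega
      · simp at hx ⊢; omega
    have h1 : polyDim (cv d n s (insert (n - 1) (range d))) = d := by
      rw [polyDim_of_affInd]
      · rw [card_insert_of_notMem hni]; simp
      · apply affInd_of
        intro i hi
        have hc : ((insert (n - 1) (range d)).erase i).card = d := by
          rw [card_erase_of_mem hi, card_insert_of_notMem hni]; simp
        refine ⟨fS d n s ((insert (n - 1) (range d)).erase i), isFn_fS d n s (by omega) _ hc,
          ?_, ?_⟩
        · apply fS_ne (by omega) (by omega) ((erase_subset _ _).trans hsub) hc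
            (by simpa using hsub hi) (by simp)
          rw [insert_erase hi]
          intro h
          have := h (mem_insert_self _ _)
          simp at this; omega
        · intro j hj hji
          exact fS_zero _ _ _ _ (mem_erase.2 ⟨hji, hj⟩)
      · exact ⟨n - 1, mem_insert_self _ _⟩
    calc d = _ := h1.symm
      _ ≤ _ := polyDim_cv_mono hsub

lemma polyDim_F {d n s : ℕ} (hd : 2 ≤ d) (hn : d + s < n) :
    polyDim (cv d n s (range (d + s))) = d - 1 := by
  apply le_antisymm
  · have : polyDim (cv d n s (range (d + s))) < d := by
      rw [polyDim_cv_eq]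
      have hlt : ∀ W : Submodule ℝ (Fin d → ℝ), W ≠ ⊤ → Module.finrank ℝ W < d := by
        intro W hW
        have := Submodule.finrank_lt hW
        simpa using this
      apply hlt
      intro htop
      obtain ⟨b, c, h⟩ := isFn_ppt d n s (by omega)
      have hle : vectorSpan ℝ (Yp d n s '' ((range (d + s) : Finset ℕ) : Set ℕ))
          ≤ LinearMap.ker (dotL b) := by
        rw [vectorSpan_def, Submodule.span_le]
        rintro _ ⟨_, ⟨i, hi, rfl⟩, _, ⟨j, hj, rfl⟩, rfl⟩
        have h1 := h i
        have h2 := h j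
        rw [ppt_zero (by simpa using hi)] at h1
        rw [ppt_zero (by simpa using hj)] at h2
        simp only [vsub_eq_sub, SetLike.mem_coe, LinearMap.mem_ker, map_sub, dotL_apply]
        linarith
      rw [htop] at hle
      have h3 : ∀ x, dotp b x = 0 := fun x => hle (Submodule.mem_top (x := x))
      have h1 := h 0
      have h2 := h (n - 1)
      rw [h3, ppt_zero (by omega)] at h1
      rw [h3] at h2
      have := ppt_pos (d := d) (s := s) (n := n) (j := n - 1) (by omega) (by omega)
      linarith
    omega
  · have h1 := polyDim_small (d := d) (n := n) (s := s) (by omega) (range d)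
      ⟨0, by simp; omega⟩ (by simp)
    rw [card_range] at h1
    rw [← h1]
    apply polyDim_cv_mono
    intro x hx
    simp at hx ⊢; omega

lemma push (R : Finset ℕ) (u g : ℕ → ℝ) (hu : ∀ j ∈ R, 0 ≤ u j) (hg : ∃ y ∈ R, g y < 0) :
    ∃ l : ℝ, (∀ j ∈ R, 0 ≤ u j + l * g j) ∧ ∃ j ∈ R, g j < 0 ∧ u j + l * g j = 0 := by
  classical
  obtain ⟨y, hy, hgy⟩ := hg
  obtain ⟨j0, hj0, hmin⟩ := Finset.exists_min_image (R.filter (fun j => g j < 0))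
    (fun j => u j / (- g j)) ⟨y, by simp [hy, hgy]⟩
  rw [mem_filter] at hj0
  have hl : 0 ≤ u j0 / (- g j0) := div_nonneg (hu _ hj0.1) (by linarith [hj0.2])
  refine ⟨u j0 / (- g j0), ?_, j0, hj0.1, hj0.2, ?_⟩
  · intro j hj
    by_cases h : g j < 0
    · have := hmin j (by simp [hj, h])
      rw [le_div_iff₀ (by linarith)] at this
      linarith
    · have := mul_nonneg hl (not_lt.1 h)
      linarith [hu j hj]
  · have : g j0 ≠ 0 := hj0.2.ne
    field_simp
    ring

lemma gale_of_d {d n s : ℕ} (hd : 2 ≤ d) (hn : d + s < n) {u : ℕ → ℝ} (hu : IsFn d n s u)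
    (h0 : ∀ j < n, 0 ≤ u j) (hne : ∃ j < n, u j ≠ 0) {S : Finset ℕ} (hSn : S ⊆ range n)
    (hc : S.card = d) (hSm : ¬ S ⊆ range (d + s)) (hz : ∀ j ∈ S, u j = 0) :
    S ∈ galeHi n d (d + s) := by
  rw [mem_galeHi, mem_galeSets]
  refine ⟨⟨hSn, hc, ?_⟩, hSm⟩
  obtain ⟨γ, hγ⟩ := isFn_eq_fS (by omega) hc hu hz
  have hγ0 : γ ≠ 0 := by
    rintro rfl
    obtain ⟨j, _, hj⟩ := hne
    apply hj; rw [hγ, zero_mul]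
  have hs : ∀ y < n, y ∉ S → 0 < γ * (-1 : ℝ) ^ upc S y := by
    intro y hy hyS
    have h1 := fS_sign (s := s) (by omega) (by omega) hSn hc hy hyS
      (fun h => hSm ((subset_insert _ _).trans h))
    have h2 := h0 y hy
    rw [hγ] at h2
    rcases Nat.even_or_odd (upc S y) with he | ho
    · rw [he.neg_one_pow] at h1 ⊢
      have : 0 ≤ γ := by
        by_contra hcon
        push Not at hcon
        nlinarith
      rw [mul_one]
      exact lt_of_le_of_ne this hγ0.symm
    · rw [ho.neg_one_pow] at h1 ⊢
      have : γ ≤ 0 := by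
        by_contra hcon
        push Not at hcon
        nlinarith
      have := lt_of_le_of_ne this hγ0
      linarith
  refine ⟨if 0 < γ then 0 else 1, fun y hy hyS => ?_⟩
  have h1 := hs y hy hyS
  rcases Nat.even_or_odd (upc S y) with he | ho
  · rw [he.neg_one_pow, mul_one] at h1
    rw [if_pos h1]; exact Nat.even_iff.1 he
  · rw [ho.neg_one_pow] at h1
    rw [if_neg (by linarith)]; exact Nat.odd_iff.1 ho

lemma zero_card_le {d n s : ℕ} (hd : 2 ≤ d) (hn : d + s < n) {u : ℕ → ℝ} (hu : IsFn d n s u)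
    (hne : ∃ j < n, u j ≠ 0) {Z : Finset ℕ} (hZn : Z ⊆ range n)
    (hZm : ¬ Z ⊆ range (d + s)) (hz : ∀ j ∈ Z, u j = 0) : Z.card ≤ d := by
  classical
  by_contra hcon
  push Not at hcon
  obtain ⟨x, hx, hxm⟩ := Finset.not_subset.1 hZm
  obtain ⟨T, hxT, hTZ, hTc⟩ := Finset.exists_subsuperset_card_eq
    (singleton_subset_iff.2 hx) (n := d) (by simp; omega) hcon.le
  obtain ⟨γ, hγ⟩ := isFn_eq_fS (by omega) hTc hu (fun j hj => hz j (hTZ hj))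
  obtain ⟨y, hy, hyT⟩ := Finset.exists_mem_notMem_of_card_lt_card (s := T) (t := Z) (by omega)
  have h1 := fS_ne (s := s) (by omega) (by omega) (hTZ.trans hZn) hTc (by simpa using hZn hy) hyT
    (fun h => hxm (h (mem_insert_of_mem (singleton_subset_iff.1 hxT))))
  have h2 := hz y hy
  rw [hγ] at h2
  have hγ0 : γ = 0 := (mul_eq_zero.1 h2).resolve_right h1
  obtain ⟨j, _, hj⟩ := hne
  apply hj; rw [hγ, hγ0, zero_mul]

lemma ext_step {d n s : ℕ} (hd : 2 ≤ d) (hn : d + s < n) : ∀ (k : ℕ) (u : ℕ → ℝ),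
    IsFn d n s u → (∀ j < n, 0 ≤ u j) → (∃ j < n, u j ≠ 0) → ∀ Z : Finset ℕ,
    Z ⊆ range n → ¬ Z ⊆ range (d + s) → (∀ j ∈ Z, u j = 0) → d ≤ Z.card + k →
    ∃ S ∈ galeHi n d (d + s), Z ⊆ S := by
  classical
  intro k
  induction k with
  | zero =>
    intro u hu h0 hne Z hZn hZm hz hk
    have := zero_card_le hd hn hu hne hZn hZm hz
    exact ⟨Z, gale_of_d hd hn hu h0 hne hZn (by omega) hZm hz, subset_rfl⟩
  | succ k ih =>
    intro u hu h0 hne Z hZn hZm hz hk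
    by_cases hc : d ≤ Z.card + k
    · exact ih u hu h0 hne Z hZn hZm hz hc
    obtain ⟨y1, hy1, huy1⟩ := hne
    have hsub : insert y1 Z ⊆ range n := by
      intro x hx
      rcases mem_insert.1 hx with rfl | hx
      · simpa using hy1
      · exact hZn hx
    obtain ⟨S, hZS, hSn, hSc⟩ := Finset.exists_subsuperset_card_eq hsub (n := d)
      ((card_insert_le _ _).trans (by omega)) (by simp; omega)
    have hZS' : Z ⊆ S := (subset_insert _ _).trans hZS
    have hSm : ¬ S ⊆ range (d + s) := fun h => hZm (hZS'.trans h)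
    obtain ⟨y, hy, hyS⟩ := Finset.exists_mem_notMem_of_card_lt_card (s := S) (t := range n)
      (by simp; omega)
    have hfy := fS_ne (s := s) (by omega) (by omega) hSn hSc (by simpa using hy) hyS
      (fun h => hSm ((subset_insert _ _).trans h))
    have hg : ∃ g, IsFn d n s g ∧ (∀ j ∈ S, g j = 0) ∧ g y < 0 := by
      rcases lt_or_gt_of_ne hfy with h | h
      · exact ⟨_, isFn_fS d n s (by omega) S hSc, fun j hj => fS_zero _ _ _ _ hj, h⟩
      · refine ⟨_, isFn_smul (isFn_fS d n s (by omega) S hSc) (-1), fun j hj => ?_, ?_⟩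
        · simp [fS_zero _ _ _ _ hj]
        · simpa using h
    obtain ⟨g, hgF, hgS, hgy⟩ := hg
    obtain ⟨l, hl, j0, hj0, hgj0, hj0z⟩ := push (range n) u g
      (fun j hj => h0 j (by simpa using hj)) ⟨y, hy, hgy⟩
    have hj0S : j0 ∉ S := fun h => by rw [hgS j0 h] at hgj0; exact lt_irrefl _ hgj0
    obtain ⟨S1, hS1, hsub1⟩ := ih (fun j => u j + l * g j) (isFn_add hu (isFn_smul hgF l))
      (fun j hj => hl j (by simpa using hj))
      ⟨y1, hy1, by simpa [hgS y1 (hZS (mem_insert_self _ _))] using huy1⟩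
      (insert j0 Z) (insert_subset hj0 hZn) (fun h => hZm ((subset_insert _ _).trans h))
      (by
        intro j hj
        rcases mem_insert.1 hj with rfl | hj
        · exact hj0z
        · simp [hz j hj, hgS j (hZS' hj)])
      (by rw [card_insert_of_notMem (fun h => hj0S (hZS' h))]; omega)
    exact ⟨S1, hS1, (subset_insert _ _).trans hsub1⟩

lemma ext_main {d n s : ℕ} (hd : 2 ≤ d) (hn : d + s < n) {u : ℕ → ℝ}
    (hu : IsFn d n s u) (h0 : ∀ j < n, 0 ≤ u j) (hne : ∃ j < n, u j ≠ 0) {Z : Finset ℕ}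
    (hZ : ∀ j, j ∈ Z ↔ j < n ∧ u j = 0) (hZm : Z ≠ range (d + s)) :
    ∃ S ∈ galeHi n d (d + s), Z ⊆ S := by
  classical
  have hZn : Z ⊆ range n := fun j hj => by simpa using ((hZ j).1 hj).1
  by_cases hs : Z ⊆ range (d + s)
  · obtain ⟨y, hy, hyZ⟩ := Finset.exists_of_ssubset (hs.ssubset_of_ne hZm)
    obtain ⟨l, hl, j0, hj0, hgj0, hj0z⟩ := push (range n) u (fun j => (-1) * ppt d n s j)
      (fun j hj => h0 j (by simpa using hj)) ⟨n - 1, by simp; omega, by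
        have := ppt_pos (d := d) (s := s) (n := n) (j := n - 1) (by omega) (by omega)
        linarith⟩
    have hj0m : ¬ j0 < d + s := fun h => by rw [ppt_zero h] at hgj0; simp at hgj0
    have hyn : y < n := by simp at hy; omega
    obtain ⟨S, hS, hsub⟩ := ext_step hd hn d _
      (isFn_add hu (isFn_smul (isFn_smul (isFn_ppt d n s (by omega)) (-1)) l))
      (fun j hj => hl j (by simpa using hj))
      ⟨y, hyn, by
        rw [ppt_zero (by simpa using hy)]
        have : u y ≠ 0 := fun h => hyZ ((hZ y).2 ⟨hyn, h⟩)
        simpa using this⟩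
      (insert j0 Z) (insert_subset hj0 hZn)
      (fun h => hj0m (by simpa using h (mem_insert_self _ _)))
      (by
        intro j hj
        rcases mem_insert.1 hj with rfl | hj
        · exact hj0z
        · rw [((hZ j).1 hj).2, ppt_zero (by simpa using hs hj)]; simp)
      (by omega)
    exact ⟨S, hS, (subset_insert _ _).trans hsub⟩
  · exact ext_step hd hn d u hu h0 hne Z hZn hs (fun j hj => ((hZ j).1 hj).2) (by omega)

lemma good_of_sub {d n s : ℕ} (hd : 2 ≤ d) (hn : d + s < n) {S Z : Finset ℕ}
    (hS : S ∈ galeHi n d (d + s)) (hZS : Z ⊆ S) :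
    ∃ u, IsFn d n s u ∧ (∀ j < n, 0 ≤ u j) ∧ ∀ j, j ∈ Z ↔ j < n ∧ u j = 0 := by
  classical
  rw [mem_galeHi, mem_galeSets] at hS
  obtain ⟨⟨hSn, hc, e, he⟩, hSm⟩ := hS
  obtain ⟨g, hg, hgS⟩ := isFn_lag d n s (by omega) S hc.le (fun j => if j ∈ Z then 0 else 1)
  set v : ℕ → ℝ := fun j => (-1) ^ e * fS d n s S j with hv
  have hvF : IsFn d n s v := isFn_smul (isFn_fS d n s (by omega) S hc) _
  have hvpos : ∀ j < n, j ∉ S → 0 < v j := by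
    intro j hj hjS
    have h1 := fS_sign (s := s) (by omega) (by omega) hSn hc hj hjS
      (fun h => hSm ((subset_insert _ _).trans h))
    rw [neg_one_pow_eq_pow_mod_two, he j hj hjS] at h1
    exact h1
  have hev : ∀ᶠ ε in nhdsWithin (0 : ℝ) (Set.Ioi 0), ∀ j ∈ range n \ S, 0 < v j + ε * g j := by
    rw [Filter.eventually_all_finset]
    intro j hj
    simp only [mem_sdiff, mem_range] at hj
    have ht : Filter.Tendsto (fun ε : ℝ => v j + ε * g j) (nhdsWithin 0 (Set.Ioi 0))
        (nhds (v j + 0 * g j)) := by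
      apply Filter.Tendsto.mono_left _ nhdsWithin_le_nhds
      apply Continuous.tendsto
      fun_prop
    apply ht.eventually_const_lt
    simpa using hvpos j hj.1 hj.2
  obtain ⟨ε, hε, hε0⟩ := (hev.and self_mem_nhdsWithin).exists
  have hε0 : 0 < ε := hε0
  refine ⟨fun j => v j + ε * g j, isFn_add hvF (isFn_smul hg ε), ?_, ?_⟩
  · intro j hj
    by_cases hjS : j ∈ S
    · simp only [hv, fS_zero _ _ _ _ hjS, hgS j hjS]
      split_ifs <;> simp [hε0.le]
    · exact (hε j (by simp [hj, hjS])).le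
  · intro j
    constructor
    · intro hj
      refine ⟨by simpa using hSn (hZS hj), ?_⟩
      simp [hv, fS_zero _ _ _ _ (hZS hj), hgS j (hZS hj), hj]
    · rintro ⟨hj, h⟩
      by_cases hjS : j ∈ S
      · simp only [hv, fS_zero _ _ _ _ hjS, hgS j hjS] at h
        by_contra hjZ
        rw [if_neg hjZ] at h
        simp at h
        exact hε0.ne' h
      · exact absurd h (hε j (by simp [hj, hjS])).ne'

lemma isFace_of {d n s : ℕ} (hd : 2 ≤ d) {u : ℕ → ℝ}
    (hu : IsFn d n s u) (h0 : ∀ j < n, 0 ≤ u j) (hne : ∃ j < n, u j ≠ 0) {Z : Finset ℕ}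
    (hZ : ∀ j, j ∈ Z ↔ j < n ∧ u j = 0) (hZe : Z.Nonempty) :
    IsFaceOf (cv d n s (range n)) (cv d n s Z) := by
  obtain ⟨b, c, h⟩ := hu
  right; right
  obtain ⟨h1, h2⟩ := face_eq hd h h0 Z hZ
  refine ⟨b, c, ?_, h1, h2.symm⟩
  rintro rfl
  obtain ⟨i, hi⟩ := hZe
  obtain ⟨j, _, hj⟩ := hne
  have h3 := h i
  rw [((hZ i).1 hi).2] at h3
  apply hj
  rw [h]
  simp only [dotp, Pi.zero_apply, zero_mul, sum_const_zero] at h3 ⊢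
  linarith

lemma face_repr {d n s : ℕ} (hd : 2 ≤ d) {G : Set (Fin d → ℝ)}
    (hG : IsFaceOf (cv d n s (range n)) G) (hGe : G.Nonempty) (hGP : G ≠ cv d n s (range n)) :
    ∃ u Z, IsFn d n s u ∧ (∀ j < n, 0 ≤ u j) ∧ (∃ j < n, u j ≠ 0) ∧
      (∀ j, j ∈ Z ↔ j < n ∧ u j = 0) ∧ G = cv d n s Z ∧ Z.Nonempty := by
  classical
  rcases hG with h | h | ⟨b, c, _, hle, hGeq⟩
  · rw [h] at hGe; exact absurd hGe Set.not_nonempty_empty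
  · exact absurd h hGP
  · set u : ℕ → ℝ := fun j => c - dotp b (Yp d n s j) with hu
    have h0 : ∀ j < n, 0 ≤ u j := by
      intro j hj
      have := hle _ (Yp_mem_cv (T := range n) (by simpa using hj))
      simp only [hu]; linarith
    have hZ : ∀ j, j ∈ (range n).filter (fun j => u j = 0) ↔ j < n ∧ u j = 0 := by simp
    have hf := face_eq hd (u := u) (fun j => rfl) h0 _ hZ
    have hGZ : G = cv d n s ((range n).filter (fun j => u j = 0)) := by rw [hGeq, hf.2]
    refine ⟨u, _, ⟨b, c, fun j => rfl⟩, h0, ?_, hZ, hGZ, ?_⟩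
    · by_contra hcon
      push Not at hcon
      apply hGP
      rw [hGZ, filter_true_of_mem]
      intro j hj
      exact hcon j (by simpa using hj)
    · rw [Finset.nonempty_iff_ne_empty]
      intro h
      rw [h] at hGZ
      rw [hGZ] at hGe
      simp [cv] at hGe

lemma F_fn {d n s : ℕ} (hd : 2 ≤ d) (hn : d + s < n) :
    ∀ j, j ∈ range (d + s) ↔ j < n ∧ ppt d n s j = 0 := by
  intro j
  rw [mem_range]
  constructor
  · intro h; exact ⟨by omega, ppt_zero h⟩
  · rintro ⟨_, h⟩
    by_contra hcon
    exact (ppt_pos (d := d) (s := s) (n := n) (j := j) (by omega) (by omega)).ne' h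

lemma faces_eq {d n s : ℕ} (hd : 2 ≤ d) (hn : d + s < n) {i : ℕ} (hi : 1 ≤ i) (hid : i ≤ d) :
    {G | IsFaceOf (cv d n s (range n)) G ∧ G.Nonempty ∧ polyDim G = i - 1}
        \ {cv d n s (range (d + s))}
      = cv d n s '' (((galeHi n d (d + s)).biUnion (fun S => S.powersetCard i) :
          Finset (Finset ℕ)) : Set (Finset ℕ)) := by
  ext G
  simp only [Set.mem_diff, Set.mem_setOf_eq, Set.mem_singleton_iff, Set.mem_image, mem_coe,
    mem_biUnion, mem_powersetCard]
  constructor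
  · rintro ⟨⟨hG, hGe, hdim⟩, hGF⟩
    obtain ⟨u, Z, hu, h0, hne, hZ, rfl, hZe⟩ := face_repr hd hG hGe (by
      rintro rfl
      rw [polyDim_P hd hn] at hdim; omega)
    obtain ⟨S, hS, hZS⟩ := ext_main hd hn hu h0 hne hZ (by rintro rfl; exact hGF rfl)
    have hSc : S.card = d := (mem_galeSets.1 (mem_galeHi.1 hS).1).2.1
    have hc := card_le_card hZS
    rw [polyDim_small (by omega) Z hZe (by omega)] at hdim
    have := card_pos.2 hZe
    exact ⟨Z, ⟨S, hS, hZS, by omega⟩, rfl⟩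
  · rintro ⟨Z, ⟨S, hS, hZS, hZc⟩, rfl⟩
    have hS' := mem_galeHi.1 hS
    have hSg := mem_galeSets.1 hS'.1
    have hZe : Z.Nonempty := card_pos.1 (by omega)
    obtain ⟨u, hu, h0, hZ⟩ := good_of_sub hd hn hS hZS
    have hne : ∃ j < n, u j ≠ 0 := by
      obtain ⟨y, hy, hyZ⟩ := Finset.exists_mem_notMem_of_card_lt_card (s := Z) (t := range n)
        (by simp; omega)
      have hy' : y < n := by simpa using hy
      exact ⟨y, hy', fun h => hyZ ((hZ y).2 ⟨hy', h⟩)⟩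
    refine ⟨⟨isFace_of hd hu h0 hne hZ hZe, ?_, ?_⟩, ?_⟩
    · obtain ⟨j, hj⟩ := hZe
      exact ⟨_, Yp_mem_cv hj⟩
    · rw [polyDim_small (by omega) Z hZe (by omega), hZc]
    · intro hF
      have hsub : range (d + s) ⊆ Z := by
        intro j hj
        apply mem_of_Yp_mem hd hu h0 Z hZ (by simp at hj; omega)
        rw [hF]; exact Yp_mem_cv hj
      have h1 := card_le_card hsub
      rw [card_range] at h1
      have h2 : range (d + s) = S := by
        apply eq_of_subset_of_card_le (hsub.trans hZS)
        rw [card_range, hSg.2.1]; omega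
      exact hS'.2 h2.symm.subset

lemma cv_injOn {d n s : ℕ} (hd : 2 ≤ d) (hn : d + s < n) (i : ℕ) :
    Set.InjOn (cv d n s) (((galeHi n d (d + s)).biUnion (fun S => S.powersetCard i) :
          Finset (Finset ℕ)) : Set (Finset ℕ)) := by
  have key : ∀ Z Z' : Finset ℕ, (∃ S ∈ galeHi n d (d + s), Z ⊆ S ∧ Z.card = i) →
      (∃ S ∈ galeHi n d (d + s), Z' ⊆ S ∧ Z'.card = i) → cv d n s Z = cv d n s Z' → Z ⊆ Z' := by
    rintro Z Z' ⟨S, hS, hZS, _⟩ ⟨S', hS', hZS', _⟩ h j hj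
    obtain ⟨u, hu, h0, hZ⟩ := good_of_sub hd hn hS' hZS'
    apply mem_of_Yp_mem hd hu h0 Z' hZ
    · simpa using (mem_galeSets.1 (mem_galeHi.1 hS).1).1 (hZS hj)
    · rw [← h]; exact Yp_mem_cv hj
  intro Z hZ Z' hZ' h
  simp only [mem_coe, mem_biUnion, mem_powersetCard] at hZ hZ'
  exact (key Z Z' hZ hZ' h).antisymm (key Z' Z hZ' hZ h.symm)

lemma fBall_eq {d n s : ℕ} (hd : 2 ≤ d) (hn : d + s < n) {i : ℕ} (hid : i ≤ d) :
    fBall (acPolytope d n s) i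
      = (((galeHi n d (d + s)).biUnion (fun S => S.powersetCard i)).card : ℤ) := by
  rw [acPolytope_eq]
  unfold fBall
  by_cases hi0 : i = 0
  · rw [if_pos hi0, hi0]
    obtain ⟨S, hS, _⟩ := cover_hi (n := n) (d := d) (m := d + s) (Z := ∅) (by omega) (by omega) hn
      (by simp) (by simp)
    have : (galeHi n d (d + s)).biUnion (fun S => S.powersetCard 0) = {∅} := by
      ext Z
      simp only [mem_biUnion, powersetCard_zero, mem_singleton]
      exact ⟨fun ⟨_, _, h⟩ => h, fun h => ⟨S, hS, h⟩⟩
    rw [this]; simp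
  · have h1 := faces_eq hd hn (i := i) (by omega) hid
    have h2 := (cv_injOn hd hn i).ncard_image
    rw [← h1, Set.ncard_coe_finset] at h2
    rw [if_neg hi0]
    by_cases hi : i = d
    · subst hi
      rw [if_pos rfl]
      have hmem : cv i n s (range (i + s)) ∈ {G | IsFaceOf (cv i n s (range n)) G ∧ G.Nonempty ∧
          polyDim G = i - 1} := by
        refine ⟨isFace_of hd (isFn_ppt i n s (by omega)) (fun j _ => ppt_nonneg (by omega))
          ⟨n - 1, by omega, (ppt_pos (by omega) (by omega)).ne'⟩ (F_fn hd hn)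
          ⟨0, by simp; omega⟩, ⟨_, Yp_mem_cv (j := 0) (by simp; omega)⟩, polyDim_F hd hn⟩
      have hfin : {G | IsFaceOf (cv i n s (range n)) G ∧ G.Nonempty ∧
          polyDim G = i - 1}.Finite := by
        apply Set.Finite.of_diff (t := {cv i n s (range (i + s))}) _ (Set.finite_singleton _)
        rw [h1]
        exact (Finset.finite_toSet _).image _
      have h3 := Set.ncard_sdiff_singleton_add_one hmem hfin
      rw [h2] at h3
      unfold fVec
      rw [← h3]; push_cast; ring
    · rw [if_neg hi, if_neg (by omega)]
      unfold fVec
      rw [← h2, Set.sdiff_singleton_eq_self]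
      rintro ⟨_, _, h⟩
      rw [polyDim_F hd hn] at h; omega

lemma hBall_eq {d n s : ℕ} (k : ℕ) (hk : k ≤ d) :
    hBall (acPolytope d n s) (k : ℤ) = htr d (fBall (acPolytope d n s)) k := by
  unfold hBall htr
  rw [if_pos ⟨by omega, by omega⟩]
  simp

lemma biUnion_eq_pc {C : Finset (Finset ℕ)} {m i : ℕ} (hC : ∀ S ∈ C, S ⊆ range m)
    (hcov : ∀ Z : Finset ℕ, Z ⊆ range m → Z.card = i → ∃ S ∈ C, Z ⊆ S) :
    ((C.biUnion (fun S => S.powersetCard i)).card : ℤ) = (m.choose i : ℤ) := by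
  have : C.biUnion (fun S => S.powersetCard i) = (range m).powersetCard i := by
    ext Z
    simp only [mem_biUnion, mem_powersetCard]
    constructor
    · rintro ⟨S, hS, h1, h2⟩; exact ⟨h1.trans (hC S hS), h2⟩
    · rintro ⟨h1, h2⟩
      obtain ⟨S, hS, h⟩ := hcov Z h1 h2
      exact ⟨S, hS, h, h2⟩
  rw [this, card_powersetCard, card_range]

lemma htr_congr {d k : ℕ} {f g : ℕ → ℤ} (h : ∀ i ≤ k, f i = g i) : htr d f k = htr d g k := by
  unfold htr
  apply sum_congr rfl
  intro i hi
  rw [h i (by simp at hi; omega)]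

lemma lower_count {n d m : ℕ} (hdn : d < n) (hdm : d ≤ m) (hmn : m ≤ n) {k : ℕ}
    (hk : 2 * k ≤ d) :
    (((galeLo n d m).filter (fun S => (S \ rset n S).card = k)).card : ℤ)
      = (Nat.multichoose (m - d) k : ℤ) := by
  classical
  have hg : ∀ S ∈ galeLo n d m, S ⊆ range n ∧ S.card = d ∧ IsGale n S := fun S hS =>
    mem_galeSets.1 (mem_galeLo.1 hS).1
  rw [← htr_partition d (galeLo n d m) (fun S => S \ rset n S) (fun S hS => (hg S hS).2.1)
    (fun S _ => sdiff_subset) ?_ ?_ (fun i => (m.choose i : ℤ)) k (by omega) ?_]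
  · have := htr_choose (m - d) k d (by omega)
    rw [show d + (m - d) = m by omega] at this
    exact this
  · intro Z hZ
    apply lower_partition hdn (galeLo n d m) (fun S hS => (mem_galeLo.1 hS).1) _ hZ
    intro S hS j hj g hgj _ hmem
    rw [mem_galeLo]
    refine ⟨hmem, ?_⟩
    have hSm := (mem_galeLo.1 hS).2
    intro x hx
    rcases mem_insert.1 hx with rfl | hx
    · have := hSm hj
      simp at this ⊢; omega
    · exact hSm (mem_of_mem_erase hx)
  · intro Z S hS T hT h1 h2 h3 h4
    obtain ⟨a1, a2, a3⟩ := hg S hS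
    obtain ⟨b1, b2, b3⟩ := hg T hT
    exact lower_unique a3 b3 a1 b1 (by rw [a2, b2]) h1 h3 h2 h4
  · intro i hi
    rw [biUnion_eq_pc (fun S hS => (mem_galeLo.1 hS).2)]
    intro Z hZ hZc
    exact cover_lo hdm hmn hZ (by omega)

lemma upper_count {n d m k : ℕ} (f : ℕ → ℤ) (hk : k ≤ d)
    (hf : ∀ i ≤ k, f i = (((galeHi n d m).biUnion (fun S => S.powersetCard i)).card : ℤ)) :
    htr d f k = (((galeHi n d m).filter (fun S => (rset n S).card = k)).card : ℤ) := by
  have hg : ∀ S ∈ galeHi n d m, S ⊆ range n ∧ S.card = d ∧ IsGale n S := fun S hS =>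
    mem_galeSets.1 (mem_galeHi.1 hS).1
  apply htr_partition d (galeHi n d m) (fun S => rset n S) (fun S hS => (hg S hS).2.1)
    (fun S _ => filter_subset _ _) (fun Z hZ => raise_partition hZ) _ f k hk hf
  intro Z S hS T hT h1 h2 h3 h4
  obtain ⟨a1, a2, a3⟩ := hg S hS
  obtain ⟨b1, b2, b3⟩ := hg T hT
  exact raise_unique a3 b3 a1 b1 (by rw [a2, b2]) h1 h3 h2 h4

/-- **h-numbers of the almost cyclic polytope.** For `d ≥ 2`, `s ≥ 0`, `n > d+s`, with
`C' = ∂C(d,n,s) − {F}`: `h_k(C') = C(n−d−1+k, k)` for `0 ≤ k ≤ ⌊(d−1)/2⌋`, and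
`h_{d−k}(C') = C(n−d−1+k, k) − C(s+k−1, k)` for `1 ≤ k ≤ ⌊d/2⌋`. -/
theorem acPolytope_h_numbers (d n s : ℕ) (hd : 2 ≤ d) (hn : d + s < n) :
    (∀ k : ℕ, k ≤ (d - 1) / 2 →
      hBall (acPolytope d n s) (k : ℤ) = ((n - d - 1 + k).choose k : ℤ)) ∧
    (∀ k : ℕ, 1 ≤ k → k ≤ d / 2 →
      hBall (acPolytope d n s) ((d : ℤ) - k)
        = ((n - d - 1 + k).choose k : ℤ) - ((s + k - 1).choose k : ℤ)) := by
  classical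
  constructor
  · intro k hk
    rw [hBall_eq k (by omega), htr_congr (g := fun i => ((d + (n - d)).choose i : ℤ)),
      htr_choose _ _ _ (by omega), Nat.multichoose_eq]
    · congr 2; omega
    · intro i hi
      rw [fBall_eq hd hn (by omega), show d + (n - d) = n by omega]
      apply biUnion_eq_pc (fun S hS => (mem_galeSets.1 (mem_galeHi.1 hS).1).1)
      intro Z hZ hZc
      exact cover_hi (by omega) (by omega) hn hZ (by omega)
  · intro k hk1 hk
    rw [show (d : ℤ) - k = ((d - k : ℕ) : ℤ) by omega, hBall_eq _ (by omega),
      upper_count (n := n) (m := d + s) _ (by omega) (fun i hi => fBall_eq hd hn (by omega))]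
    have h1 := lower_count (n := n) (d := d) (m := n) (k := k) (by omega) (by omega) le_rfl
      (by omega)
    have h2 := lower_count (n := n) (d := d) (m := d + s) (k := k) (by omega) (by omega) hn.le
      (by omega)
    rw [Nat.multichoose_eq] at h1 h2
    have e1 : n - d + k - 1 = n - d - 1 + k := by omega
    have e2 : d + s - d + k - 1 = s + k - 1 := by omega
    rw [e1] at h1
    rw [e2] at h2
    rw [← h1, ← h2, eq_sub_iff_add_eq]
    norm_cast
    rw [← card_union_of_disjoint]
    · congr 1
      ext S
      simp only [mem_union, mem_filter, mem_galeHi, mem_galeLo]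
      have hcs : S ∈ galeSets n d → ((rset n S).card = d - k ↔ (S \ rset n S).card = k) := by
        intro hS
        have hc := (mem_galeSets.1 hS).2.1
        have hsub : rset n S ⊆ S := filter_subset _ _
        have h5 := card_sdiff_add_card_eq_card hsub
        omega
      have hr : S ∈ galeSets n d → S ⊆ range n := fun h => (mem_galeSets.1 h).1
      tauto
    · rw [disjoint_left]
      intro S hS hS'
      simp only [mem_filter, mem_galeHi, mem_galeLo] at hS hS'
      exact hS.1.2 hS'.1.2

end

end ASP
end

section
/- (h-numbers of neighborly almost simplicial polytopes.) Let P ∈ P(d,n,s) be ⌊(d−1)/2⌋-neighborly, with ASP-pair (P,F), and let P' be the complex of all proper faces of P except F. Then h_k(P') = C(n−d−1+k, k) for 0 ≤ k ≤ ⌊(d−1)/2⌋, and h_{d−k}(P') = C(n−d−1+k, k) − C(s+k−1, k) for 1 ≤ k ≤ ⌊(d−1)/2⌋, where C(a,b) denotes the binomial coefficient. -/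
open Finset

namespace ASP

noncomputable section

section config

open scoped Classical Topology
open Filter Matrix

variable {d : ℕ} {ι : Type}

/-- polar dual -/
def DD (V : Finset ι) (q : ι → Fin d → ℝ) : Set (Fin d → ℝ) :=
  {β | ∀ v ∈ V, β ⬝ᵥ q v ≤ 1}

/-- tight set -/
def TT (V : Finset ι) (q : ι → Fin d → ℝ) (β : Fin d → ℝ) : Finset ι :=
  V.filter (fun v => β ⬝ᵥ q v = 1)

lemma mem_TT {V : Finset ι} {q : ι → Fin d → ℝ} {β : Fin d → ℝ} {v : ι} :
    v ∈ TT V q β ↔ v ∈ V ∧ β ⬝ᵥ q v = 1 := by simp [TT]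

lemma perturb (V : Finset ι) (q : ι → Fin d → ℝ) (β γ : Fin d → ℝ) (hβ : β ∈ DD V q)
    (hγ : ∀ v ∈ TT V q β, γ ⬝ᵥ q v ≤ 0) :
    ∀ᶠ τ : ℝ in 𝓝[>] 0, β + τ • γ ∈ DD V q ∧
      TT V q (β + τ • γ) = (TT V q β).filter (fun v => γ ⬝ᵥ q v = 0) := by
  have key : ∀ v ∈ V, ∀ᶠ τ : ℝ in 𝓝[>] 0, ((β + τ • γ) ⬝ᵥ q v ≤ 1 ∧
      ((β + τ • γ) ⬝ᵥ q v = 1 ↔ (β ⬝ᵥ q v = 1 ∧ γ ⬝ᵥ q v = 0))) := by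
    intro v hv
    rcases (hβ v hv).lt_or_eq with h | h
    · have hc : Continuous (fun τ : ℝ => β ⬝ᵥ q v + τ * (γ ⬝ᵥ q v)) := by fun_prop
      have ht : ∀ᶠ τ : ℝ in 𝓝 0, β ⬝ᵥ q v + τ * (γ ⬝ᵥ q v) < 1 :=
        hc.continuousAt.eventually_lt continuousAt_const (by simpa using h)
      filter_upwards [nhdsWithin_le_nhds ht] with τ hτ
      rw [add_dotProduct, smul_dotProduct, smul_eq_mul]
      exact ⟨hτ.le, ⟨fun h1 => absurd h1 hτ.ne, fun h1 => absurd h1.1 h.ne⟩⟩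
    · filter_upwards [self_mem_nhdsWithin] with τ hτ
      have hτ : 0 < τ := hτ
      have hg := hγ v (mem_TT.2 ⟨hv, h⟩)
      rw [add_dotProduct, smul_dotProduct, smul_eq_mul, h]
      refine ⟨by nlinarith, ⟨fun h1 => ⟨rfl, ?_⟩, fun h1 => by rw [h1.2]; ring⟩⟩
      have : τ * (γ ⬝ᵥ q v) = 0 := by linarith
      exact (mul_eq_zero.1 this).resolve_left hτ.ne'
  have := (Filter.eventually_all_finset V).2 key
  filter_upwards [this] with τ hτ
  refine ⟨fun v hv => (hτ v hv).1, ?_⟩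
  ext v
  simp only [mem_TT, Finset.mem_filter]
  constructor
  · rintro ⟨hv, h1⟩
    have := (hτ v hv).2.1 h1
    exact ⟨⟨hv, this.1⟩, this.2⟩
  · rintro ⟨⟨hv, h1⟩, h2⟩
    exact ⟨hv, (hτ v hv).2.2 ⟨h1, h2⟩⟩

lemma exists_vec (f : (Fin d → ℝ) →ₗ[ℝ] ℝ) : ∃ b : Fin d → ℝ, ∀ x, f x = b ⬝ᵥ x := by
  refine ⟨(dotProductEquiv ℝ (Fin d)).symm f, fun x => ?_⟩
  have := LinearMap.congr_fun ((dotProductEquiv ℝ (Fin d)).apply_symm_apply f) x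
  rw [← this]
  rfl

lemma exists_annih (s : Set (Fin d → ℝ)) (h : Submodule.span ℝ s ≠ ⊤) :
    ∃ b : Fin d → ℝ, b ≠ 0 ∧ ∀ x ∈ s, b ⬝ᵥ x = 0 := by
  obtain ⟨f, hf, hle⟩ := Submodule.exists_le_ker_of_lt_top _ (lt_top_iff_ne_top.2 h)
  obtain ⟨b, hb⟩ := exists_vec f
  refine ⟨b, ?_, fun x hx => ?_⟩
  · rintro rfl
    apply hf
    ext x
    simp [hb]
  · rw [← hb]
    exact hle (Submodule.subset_span hx)

lemma exists_facet (V : Finset ι) (q : ι → Fin d → ℝ) (R : ℝ)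
    (hR : ∀ β ∈ DD V q, ∀ i, |β i| ≤ R) (K : Fin d → ℝ) (hK : K ∈ DD V q) (u : Fin d → ℝ) :
    ∃ β ∈ DD V q, Submodule.span ℝ (q '' (TT V q β)) = ⊤ ∧ TT V q K ⊆ TT V q β ∧
      ∀ β' ∈ DD V q, TT V q K ⊆ TT V q β' → β' ⬝ᵥ u ≤ β ⬝ᵥ u := by
  set S : Set (Fin d → ℝ) := {β | β ∈ DD V q ∧ TT V q K ⊆ TT V q β} with hS
  have hSeq : S = (⋂ v ∈ V, {β | β ⬝ᵥ q v ≤ 1}) ∩ ⋂ v ∈ TT V q K, {β | β ⬝ᵥ q v = 1} := by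
    ext β
    simp only [hS, DD, Set.mem_ofPred_eq, Set.mem_inter_iff, Set.mem_iInter]
    refine and_congr_right fun _ => ⟨fun h v hv => (mem_TT.1 (h hv)).2, fun h v hv => ?_⟩
    exact mem_TT.2 ⟨(mem_TT.1 hv).1, h v hv⟩
  have hcl : IsClosed S := by
    rw [hSeq]
    refine IsClosed.inter (isClosed_biInter fun v _ => ?_) (isClosed_biInter fun v _ => ?_)
    · exact isClosed_le (by fun_prop) (by fun_prop)
    · exact isClosed_eq (by fun_prop) (by fun_prop)
  have hcomp : IsCompact S := by
    refine IsCompact.of_isClosed_subset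
      (isCompact_univ_pi (fun _ : Fin d => isCompact_Icc (a := -R) (b := R))) hcl ?_
    intro β hβ i _
    exact abs_le.1 (hR β hβ.1 i)
  have hne : S.Nonempty := ⟨K, hK, Finset.Subset.refl _⟩
  have hcont : Continuous (fun β : Fin d → ℝ => β ⬝ᵥ u) := by fun_prop
  obtain ⟨m, hm, hmax⟩ := hcomp.exists_isMaxOn hne hcont.continuousOn
  set S' : Set (Fin d → ℝ) := S ∩ {β | m ⬝ᵥ u ≤ β ⬝ᵥ u} with hS'
  have hcomp' : IsCompact S' := hcomp.inter_right (isClosed_le (by fun_prop) hcont)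
  obtain ⟨β, hβ⟩ := hcomp'.extremePoints_nonempty ⟨m, hm, by simp⟩
  rw [mem_extremePoints] at hβ
  obtain ⟨⟨⟨hβD, hβT⟩, hβm⟩, hext⟩ := hβ
  have hmx : ∀ β' ∈ S, β' ⬝ᵥ u ≤ β ⬝ᵥ u := fun β' hβ' => le_trans (hmax hβ') hβm
  refine ⟨β, hβD, ?_, hβT, fun β' h1 h2 => hmx β' ⟨h1, h2⟩⟩
  by_contra hsp
  obtain ⟨γ, hγ0, hγ⟩ := exists_annih _ hsp
  have hγ' : ∀ v ∈ TT V q β, γ ⬝ᵥ q v = 0 := fun v hv => hγ _ ⟨v, hv, rfl⟩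
  have e1 := perturb V q β γ hβD (fun v hv => (hγ' v hv).le)
  have e2 := perturb V q β (-γ) hβD (fun v hv => by rw [neg_dotProduct, hγ' v hv]; simp)
  obtain ⟨τ, ⟨⟨hD1, hT1⟩, hD2, hT2⟩, hτ⟩ := ((e1.and e2).and self_mem_nhdsWithin).exists
  have hτ : 0 < τ := hτ
  have f1 : (TT V q β).filter (fun v => γ ⬝ᵥ q v = 0) = TT V q β :=
    Finset.filter_true_of_mem hγ'
  have f2 : (TT V q β).filter (fun v => (-γ) ⬝ᵥ q v = 0) = TT V q β :=
    Finset.filter_true_of_mem (fun v hv => by rw [neg_dotProduct, hγ' v hv]; simp)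
  rw [f1] at hT1
  rw [f2] at hT2
  have s1 : β + τ • γ ∈ S := ⟨hD1, by rw [hT1]; exact hβT⟩
  have s2 : β + τ • (-γ) ∈ S := ⟨hD2, by rw [hT2]; exact hβT⟩
  have m1 := hmx _ s1
  have m2 := hmx _ s2
  rw [add_dotProduct, smul_dotProduct, smul_eq_mul] at m1 m2
  rw [neg_dotProduct] at m2
  have hz : τ * (γ ⬝ᵥ u) = 0 := by linarith
  have hβm : m ⬝ᵥ u ≤ β ⬝ᵥ u := hβm
  have := (hext (β + τ • γ) ⟨s1, ?_⟩ (β + τ • (-γ)) ⟨s2, ?_⟩ ?_).1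
  · have h0 : τ • γ = 0 := by simpa using this
    exact hγ0 ((smul_eq_zero.1 h0).resolve_left hτ.ne')
  · show m ⬝ᵥ u ≤ _
    rw [add_dotProduct, smul_dotProduct, smul_eq_mul]; linarith
  · show m ⬝ᵥ u ≤ _
    rw [add_dotProduct, smul_dotProduct, smul_eq_mul, neg_dotProduct]; linarith
  · refine ⟨1/2, 1/2, by norm_num, by norm_num, by norm_num, ?_⟩
    ext i
    simp
    ring

lemma exists_generic (L : Finset (Fin d → ℝ)) (hL : ∀ γ ∈ L, γ ≠ 0) :
    ∀ U : Set (Fin d → ℝ), IsOpen U → U.Nonempty → ∃ u ∈ U, ∀ γ ∈ L, γ ⬝ᵥ u ≠ 0 := by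
  induction L using Finset.induction_on with
  | empty => rintro U _ ⟨u, hu⟩; exact ⟨u, hu, by simp⟩
  | insert γ L _ ih =>
    rintro U hU ⟨u, hu⟩
    have hγ : γ ≠ 0 := hL γ (Finset.mem_insert_self _ _)
    have hU' : IsOpen (U ∩ {x | γ ⬝ᵥ x ≠ 0}) :=
      hU.inter (isOpen_ne_fun (by fun_prop) (by fun_prop))
    obtain ⟨x, ⟨hxU, hx⟩, hxL⟩ := ih (fun g hg => hL g (Finset.mem_insert_of_mem hg)) _ hU' (by
      by_cases h : γ ⬝ᵥ u = 0
      · have hc : Continuous (fun τ : ℝ => u + τ • γ) := by fun_prop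
        have : ∀ᶠ τ : ℝ in 𝓝 0, u + τ • γ ∈ U :=
          hc.continuousAt.eventually (by simpa using hU.mem_nhds hu)
        have this' : ∀ᶠ τ : ℝ in 𝓝[>] 0, u + τ • γ ∈ U := nhdsWithin_le_nhds this
        obtain ⟨τ, h1, h2⟩ := (this'.and self_mem_nhdsWithin).exists
        have h2 : 0 < τ := h2
        refine ⟨_, h1, ?_⟩
        show γ ⬝ᵥ (u + τ • γ) ≠ 0
        rw [dotProduct_add, h, dotProduct_smul, zero_add, smul_eq_mul]
        exact mul_ne_zero h2.ne' (by simpa [dotProduct_self_eq_zero] using hγ)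
      · exact ⟨u, hu, h⟩)
    refine ⟨x, hxU, ?_⟩
    intro g hg
    rcases Finset.mem_insert.1 hg with rfl | hg
    · exact hx
    · exact hxL g hg

lemma exists_dual (q : ι → Fin d → ℝ) (T : Finset ι) (hT : Submodule.span ℝ (q '' T) = ⊤)
    (hc : T.card = d) :
    ∃ γ : ι → Fin d → ℝ, (∀ w ∈ T, ∀ w' ∈ T, γ w ⬝ᵥ q w' = if w = w' then 1 else 0) ∧
      ∀ u, u = ∑ w ∈ T, (γ w ⬝ᵥ u) • q w := by
  let b0 : T → Fin d → ℝ := fun w => q w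
  have hr : Set.range b0 = q '' T := by
    ext x; simp [b0]
  let b := basisOfTopLeSpanOfCardEqFinrank b0 (by rw [hr, hT]) (by simp [hc])
  have hb : ∀ w, b w = q w := fun w => by simp [b, b0]
  have : ∀ w : ι, ∃ g : Fin d → ℝ, ∀ h : w ∈ T, ∀ x, b.coord ⟨w, h⟩ x = g ⬝ᵥ x := by
    intro w
    by_cases h : w ∈ T
    · obtain ⟨g, hg⟩ := exists_vec (b.coord ⟨w, h⟩)
      exact ⟨g, fun _ x => hg x⟩
    · exact ⟨0, fun h' => absurd h' h⟩
  choose γ hγ using this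
  refine ⟨γ, fun w hw w' hw' => ?_, fun u => ?_⟩
  · rw [← hγ w hw, ← hb ⟨w', hw'⟩, Module.Basis.coord_apply, Module.Basis.repr_self,
      Finsupp.single_apply]
    simp [eq_comm]
  · conv_lhs => rw [← b.sum_repr u]
    rw [← Finset.sum_coe_sort T]
    refine Finset.sum_congr rfl fun w _ => ?_
    rw [← hγ w.1 w.2, hb]
    rfl

end config

section config2

open scoped Classical Topology
open Filter Matrix

variable {d : ℕ} {ι : Type}

/-- all faces as tight sets -/
def FF (V : Finset ι) (q : ι → Fin d → ℝ) : Finset (Finset ι) :=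
  V.powerset.filter (fun A => ∃ β ∈ DD V q, TT V q β = A)

lemma mem_FF {V : Finset ι} {q : ι → Fin d → ℝ} {A : Finset ι} :
    A ∈ FF V q ↔ ∃ β ∈ DD V q, TT V q β = A := by
  simp only [FF, Finset.mem_filter, Finset.mem_powerset]
  refine ⟨fun h => h.2, fun h => ⟨?_, h⟩⟩
  obtain ⟨β, _, rfl⟩ := h
  exact Finset.filter_subset _ _

lemma simplex_sub {V : Finset ι} {q : ι → Fin d → ℝ} {G A : Finset ι} (hG : G ∈ FF V q)
    (hs : Submodule.span ℝ (q '' G) = ⊤) (hc : G.card = d) (hA : A ⊆ G) : A ∈ FF V q := by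
  obtain ⟨β, hβ, rfl⟩ := mem_FF.1 hG
  obtain ⟨γ, hγ, _⟩ := exists_dual q _ hs hc
  have hv : ∀ v ∈ TT V q β, (-∑ w ∈ TT V q β \ A, γ w) ⬝ᵥ q v = if v ∈ A then 0 else -1 := by
    intro v hv
    rw [neg_dotProduct, sum_dotProduct]
    rw [Finset.sum_congr rfl (fun w hw => hγ w (Finset.mem_sdiff.1 hw).1 v hv)]
    rw [Finset.sum_ite_eq']
    by_cases h : v ∈ A <;> simp [h, hv]
  obtain ⟨τ, h1, h2⟩ := (perturb V q β (-∑ w ∈ TT V q β \ A, γ w) hβ (fun v h => by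
    rw [hv v h]; split_ifs <;> norm_num)).exists
  refine mem_FF.2 ⟨_, h1, ?_⟩
  rw [h2]
  ext v
  simp only [Finset.mem_filter]
  constructor
  · rintro ⟨h, h'⟩
    rw [hv v h] at h'
    by_contra hn
    simp [hn] at h'
  · intro h
    exact ⟨hA h, by rw [hv v (hA h)]; simp [h]⟩

lemma facet_max {V : Finset ι} {q : ι → Fin d → ℝ} {G A : Finset ι} {β u : Fin d → ℝ}
    {γ : ι → Fin d → ℝ} (hβG : TT V q β = G)
    (hu : u = ∑ w ∈ G, (γ w ⬝ᵥ u) • q w)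
    (hpos : ∀ w ∈ G, w ∉ A → 0 < γ w ⬝ᵥ u) {β' : Fin d → ℝ} (hβ' : β' ∈ DD V q)
    (hA : A ⊆ TT V q β') :
    β' ⬝ᵥ u ≤ β ⬝ᵥ u ∧ (β' ⬝ᵥ u = β ⬝ᵥ u → G ⊆ TT V q β') := by
  have e : ∀ b : Fin d → ℝ, b ⬝ᵥ u = ∑ w ∈ G, (γ w ⬝ᵥ u) * (b ⬝ᵥ q w) := by
    intro b
    conv_lhs => rw [hu]
    rw [dotProduct_sum]
    simp [dotProduct_smul]
  have hGV : ∀ w ∈ G, w ∈ V ∧ β ⬝ᵥ q w = 1 := fun w hw => by rw [← hβG] at hw; exact mem_TT.1 hw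
  have e2 : β ⬝ᵥ u - β' ⬝ᵥ u = ∑ w ∈ G, (γ w ⬝ᵥ u) * (1 - β' ⬝ᵥ q w) := by
    rw [e β, e β', ← Finset.sum_sub_distrib]
    refine Finset.sum_congr rfl fun w hw => ?_
    rw [(hGV w hw).2]; ring
  have nn : ∀ w ∈ G, 0 ≤ (γ w ⬝ᵥ u) * (1 - β' ⬝ᵥ q w) := by
    intro w hw
    by_cases h : w ∈ A
    · rw [(mem_TT.1 (hA h)).2]; simp
    · exact mul_nonneg (hpos w hw h).le (by have := hβ' w (hGV w hw).1; linarith)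
  have hsum := Finset.sum_nonneg nn
  refine ⟨by linarith, fun heq w hw => ?_⟩
  have h0 : ∑ w ∈ G, (γ w ⬝ᵥ u) * (1 - β' ⬝ᵥ q w) = 0 := by linarith
  have := (Finset.sum_eq_zero_iff_of_nonneg nn).1 h0 w hw
  by_cases h : w ∈ A
  · exact hA h
  · rcases mul_eq_zero.1 this with h' | h'
    · exact absurd h' (hpos w hw h).ne'
    · exact mem_TT.2 ⟨(hGV w hw).1, by linarith⟩

lemma facet_unique {V : Finset ι} {q : ι → Fin d → ℝ} {β β' : Fin d → ℝ}
    (hs : Submodule.span ℝ (q '' (TT V q β)) = ⊤) (h : TT V q β ⊆ TT V q β') : β' = β := by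
  apply (dotProductEquiv ℝ (Fin d)).injective
  apply LinearMap.ext_on hs
  rintro _ ⟨v, hv, rfl⟩
  show β' ⬝ᵥ q v = β ⬝ᵥ q v
  rw [(mem_TT.1 (h hv)).2, (mem_TT.1 hv).2]

lemma facet_pos {V : Finset ι} {q : ι → Fin d → ℝ} {G A : Finset ι} {β u : Fin d → ℝ}
    {γ : ι → Fin d → ℝ} (hβ : β ∈ DD V q) (hβG : TT V q β = G)
    (hγ : ∀ w ∈ G, ∀ w' ∈ G, γ w ⬝ᵥ q w' = if w = w' then 1 else 0) (hAG : A ⊆ G)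
    (hmax : ∀ β' ∈ DD V q, A ⊆ TT V q β' → β' ⬝ᵥ u ≤ β ⬝ᵥ u) (w : ι) (hw : w ∈ G)
    (hwA : w ∉ A) : 0 ≤ γ w ⬝ᵥ u := by
  subst hβG
  obtain ⟨τ, ⟨h1, h2⟩, hτ⟩ := ((perturb V q β (-γ w) hβ (fun v h => by
    rw [neg_dotProduct, hγ w hw v h]; split_ifs <;> norm_num)).and self_mem_nhdsWithin).exists
  have hτ : 0 < τ := hτ
  have := hmax _ h1 (by
    rw [h2]
    intro v hv
    refine Finset.mem_filter.2 ⟨hAG hv, ?_⟩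
    rw [neg_dotProduct, hγ w hw v (hAG hv), if_neg (by rintro rfl; exact hwA hv), neg_zero])
  rw [add_dotProduct, smul_dotProduct, neg_dotProduct, smul_eq_mul] at this
  by_contra hn
  push Not at hn
  nlinarith

lemma count_sub (G N : Finset ι) (hN : N ⊆ G) (i : ℕ) (hi : i ≤ G.card) :
    (G.powerset.filter (fun A => A.card = i ∧ ∀ w ∈ G, w ∉ A → w ∈ N)).card
      = N.card.choose (G.card - i) := by
  rw [← Finset.card_powersetCard]
  refine Finset.card_bij' (fun A _ => G \ A) (fun B _ => G \ B) ?_ ?_ ?_ ?_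
  · intro A hA
    simp only [Finset.mem_filter, Finset.mem_powerset] at hA
    rw [Finset.mem_powersetCard]
    refine ⟨fun w hw => ?_, by rw [Finset.card_sdiff_of_subset hA.1, hA.2.1]⟩
    rw [Finset.mem_sdiff] at hw
    exact hA.2.2 w hw.1 hw.2
  · intro B hB
    rw [Finset.mem_powersetCard] at hB
    simp only [Finset.mem_filter, Finset.mem_powerset]
    refine ⟨Finset.sdiff_subset, ?_, ?_⟩
    · rw [Finset.card_sdiff_of_subset (hB.1.trans hN), hB.2]; omega
    · intro w hw hw'
      simp only [Finset.mem_sdiff, not_and, not_not] at hw'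
      exact hB.1 (hw' hw)
  · intro A hA
    simp only [Finset.mem_filter, Finset.mem_powerset] at hA
    exact Finset.sdiff_sdiff_eq_self hA.1
  · intro B hB
    rw [Finset.mem_powersetCard] at hB
    exact Finset.sdiff_sdiff_eq_self (hB.1.trans hN)

/-- generic counting -/
lemma count_dir (X 𝒢 : Finset (Finset ι)) (N : Finset ι → Finset ι)
    (hN : ∀ G ∈ 𝒢, N G ⊆ G) (hc : ∀ G ∈ 𝒢, G.card = d) (p : Finset ι → Prop)
    (hsub : ∀ G ∈ 𝒢, ∀ A, A ⊆ G → A ∈ X)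
    (hex : ∀ A ∈ X, p A → ∃! G, G ∈ 𝒢 ∧ A ⊆ G ∧ ∀ w ∈ G, w ∉ A → w ∈ N G)
    (hno : ∀ A ∈ X, ¬ p A → ∀ G ∈ 𝒢, A ⊆ G → ¬ ∀ w ∈ G, w ∉ A → w ∈ N G)
    (i : ℕ) (hi : i ≤ d) :
    (X.filter (fun A => A.card = i ∧ p A)).card = ∑ G ∈ 𝒢, (N G).card.choose (d - i) := by
  have h := Finset.sum_card_bipartiteAbove_eq_sum_card_bipartiteBelow
    (fun (A G : Finset ι) => A ⊆ G ∧ ∀ w ∈ G, w ∉ A → w ∈ N G)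
    (s := X.filter (fun A => A.card = i)) (t := 𝒢)
  have l : ∀ A ∈ X.filter (fun A => A.card = i), (Finset.bipartiteAbove
      (fun (A G : Finset ι) => A ⊆ G ∧ ∀ w ∈ G, w ∉ A → w ∈ N G) 𝒢 A).card
      = if p A then 1 else 0 := by
    intro A hA
    have hA := (Finset.mem_filter.1 hA).1
    split_ifs with hp
    · rw [Finset.card_eq_one]
      obtain ⟨G, hG, hu⟩ := hex A hA hp
      refine ⟨G, Finset.ext fun H => ?_⟩
      simp only [Finset.mem_bipartiteAbove, Finset.mem_singleton]
      exact ⟨fun h => hu H h, fun h => h ▸ hG⟩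
    · rw [Finset.card_eq_zero, Finset.eq_empty_iff_forall_notMem]
      intro G hG
      rw [Finset.mem_bipartiteAbove] at hG
      exact hno A hA hp G hG.1 hG.2.1 hG.2.2
  rw [Finset.sum_congr rfl l, ← Finset.card_filter, Finset.filter_filter] at h
  rw [h]
  refine Finset.sum_congr rfl fun G hG => ?_
  rw [← hc G hG, ← count_sub G (N G) (hN G hG) i (by rw [hc G hG]; exact hi)]
  congr 1
  ext A
  simp only [Finset.mem_bipartiteBelow, Finset.mem_filter, Finset.mem_powerset]
  exact ⟨fun h => ⟨h.2.1, h.1.2, h.2.2⟩, fun h => ⟨⟨hsub G hG A h.1, h.2.1⟩, h.1, h.2.2⟩⟩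

set_option maxHeartbeats 1000000 in
theorem config_main (V : Finset ι) (q : ι → Fin d → ℝ) (R : ℝ)
    (hR : ∀ β ∈ DD V q, ∀ i, |β i| ≤ R) (F : Finset ι) (hF : F ∈ FF V q)
    (hFs : Submodule.span ℝ (q '' F) = ⊤)
    (hsimp : ∀ A ∈ FF V q, Submodule.span ℝ (q '' A) = ⊤ → A ≠ F → A.card = d) :
    ∃ (𝒢 : Finset (Finset ι)) (m : Finset ι → ℕ),
      (∀ G ∈ 𝒢, m G ≤ d) ∧
      (∀ A ∈ (FF V q).erase F, Module.finrank ℝ (Submodule.span ℝ (q '' A)) = A.card) ∧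
      (∀ i ≤ d, (((FF V q).erase F).filter (fun A => A.card = i)).card
        = ∑ G ∈ 𝒢, (m G).choose (d - i)) ∧
      (∀ i ≤ d, (((FF V q).erase F).filter (fun A => A.card = i ∧ ¬ A ⊆ F)).card
        = ∑ G ∈ 𝒢, (d - m G).choose (d - i)) := by
  obtain ⟨𝒢, h𝒢⟩ : ∃ 𝒢 : Finset (Finset ι), 𝒢 = ((FF V q).erase F).filter (fun A : Finset ι =>
      Submodule.span ℝ (q '' (A : Set ι)) = ⊤) := ⟨_, rfl⟩
  have m𝒢 : ∀ G, G ∈ 𝒢 ↔ G ≠ F ∧ G ∈ FF V q ∧ Submodule.span ℝ (q '' G) = ⊤ := by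
    intro G; simp [h𝒢, and_assoc]
  have hc : ∀ G ∈ 𝒢, G.card = d := fun G hG => by
    obtain ⟨h1, h2, h3⟩ := (m𝒢 G).1 hG
    exact hsimp G h2 h3 h1
  have hb : ∀ A, ∃ β, A ∈ FF V q → β ∈ DD V q ∧ TT V q β = A := by
    intro A
    by_cases h : A ∈ FF V q
    · obtain ⟨β, h1, h2⟩ := mem_FF.1 h
      exact ⟨β, fun _ => ⟨h1, h2⟩⟩
    · exact ⟨0, fun h' => absurd h' h⟩
  choose b hb using hb
  have hg : ∀ G, ∃ γ : ι → Fin d → ℝ, G ∈ 𝒢 →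
      (∀ w ∈ G, ∀ w' ∈ G, γ w ⬝ᵥ q w' = if w = w' then 1 else 0) ∧
      ∀ u, u = ∑ w ∈ G, (γ w ⬝ᵥ u) • q w := by
    intro G
    by_cases h : G ∈ 𝒢
    · obtain ⟨γ, h1⟩ := exists_dual q G ((m𝒢 G).1 h).2.2 (hc G h)
      exact ⟨γ, fun _ => h1⟩
    · exact ⟨0, fun h' => absurd h' h⟩
  choose γ hγ using hg
  have huniq : ∀ A B, A ∈ FF V q → B ∈ FF V q → Submodule.span ℝ (q '' A) = ⊤ → A ⊆ B → A = B := by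
    intro A B hA hB hs hAB
    have := facet_unique (V := V) (q := q) (β := b A) (β' := b B)
      (by rw [(hb A hA).2]; exact hs) (by rw [(hb A hA).2, (hb B hB).2]; exact hAB)
    rw [← (hb A hA).2, ← (hb B hB).2, this]
  -- choose u
  let U : Set (Fin d → ℝ) := ⋂ A ∈ (FF V q).erase F, {u | b A ⬝ᵥ u < b F ⬝ᵥ u}
  have hUo : IsOpen U := isOpen_biInter_finset fun A _ => isOpen_lt (by fun_prop) (by fun_prop)
  have hUn : U.Nonempty := by
    refine ⟨∑ v ∈ F, q v, ?_⟩
    simp only [U, Set.mem_iInter]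
    intro A hA
    obtain ⟨hAF, hA⟩ := Finset.mem_erase.1 hA
    show b A ⬝ᵥ _ < b F ⬝ᵥ _
    rw [dotProduct_sum, dotProduct_sum]
    have hF1 : ∀ v ∈ F, v ∈ V ∧ b F ⬝ᵥ q v = 1 := fun v hv => by
      rw [← (hb F hF).2] at hv; exact mem_TT.1 hv
    have hnot : ¬ F ⊆ A := fun h => hAF (huniq F A hF hA hFs h).symm
    obtain ⟨v, hv, hvA⟩ := Finset.not_subset.1 hnot
    refine Finset.sum_lt_sum (fun w hw => ?_) ⟨v, hv, ?_⟩
    · rw [(hF1 w hw).2]; exact (hb A hA).1 w (hF1 w hw).1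
    · rw [(hF1 v hv).2]
      refine lt_of_le_of_ne ((hb A hA).1 v (hF1 v hv).1) fun h => hvA ?_
      rw [← (hb A hA).2]; exact mem_TT.2 ⟨(hF1 v hv).1, h⟩
  obtain ⟨u, huU, hgen⟩ := exists_generic (𝒢.biUnion fun G => G.image (γ G)) (by
    intro g hg
    simp only [Finset.mem_biUnion, Finset.mem_image] at hg
    obtain ⟨G, hG, w, hw, rfl⟩ := hg
    intro h0
    have := (hγ G hG).1 w hw w hw
    rw [h0] at this
    simp at this) U hUo hUn
  have hgen' : ∀ G ∈ 𝒢, ∀ w ∈ G, γ G w ⬝ᵥ u ≠ 0 := fun G hG w hw => hgen _ (by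
    simp only [Finset.mem_biUnion, Finset.mem_image]
    exact ⟨G, hG, w, hw, rfl⟩)
  have huA : ∀ A ∈ FF V q, A ≠ F → b A ⬝ᵥ u < b F ⬝ᵥ u := by
    intro A hA hAF
    simp only [U, Set.mem_iInter] at huU
    exact huU A (Finset.mem_erase.2 ⟨hAF, hA⟩)
  have hsub : ∀ G ∈ 𝒢, ∀ A, A ⊆ G → A ∈ (FF V q).erase F := by
    intro G hG A hAG
    obtain ⟨h1, h2, h3⟩ := (m𝒢 G).1 hG
    refine Finset.mem_erase.2 ⟨?_, simplex_sub h2 h3 (hc G hG) hAG⟩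
    rintro rfl
    exact h1 (huniq _ _ hF h2 hFs hAG).symm
  -- existence
  have hexist : ∀ A ∈ FF V q, ∀ u' : Fin d → ℝ, (∀ G ∈ 𝒢, ∀ w ∈ G, γ G w ⬝ᵥ u' ≠ 0) →
      (A ⊆ F → b F ⬝ᵥ u' < b A ⬝ᵥ u') →
      ∃ G, G ∈ 𝒢 ∧ A ⊆ G ∧ ∀ w ∈ G, w ∉ A → 0 < γ G w ⬝ᵥ u' := by
    intro A hA u' hg' hAF
    obtain ⟨β, hβ, hs, hT, hmax⟩ := exists_facet V q R hR (b A) (hb A hA).1 u'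
    rw [(hb A hA).2] at hT hmax
    have hm : TT V q β ∈ FF V q := mem_FF.2 ⟨β, hβ, rfl⟩
    have hG : TT V q β ∈ 𝒢 := by
      rw [m𝒢]
      refine ⟨fun h => ?_, hm, hs⟩
      rw [h] at hT
      have h1 := hmax _ (hb A hA).1 (by rw [(hb A hA).2])
      have h2 : b F = β := facet_unique hs (by rw [h, (hb F hF).2])
      have := hAF hT
      rw [h2] at this
      linarith
    refine ⟨_, hG, hT, fun w hw hwA => lt_of_le_of_ne ?_ (hg' _ hG w hw).symm⟩
    exact facet_pos hβ rfl (hγ _ hG).1 hT hmax w hw hwA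
  have hmaxx : ∀ A ∈ FF V q, ∀ u' : Fin d → ℝ, ∀ G ∈ 𝒢,
      (∀ w ∈ G, w ∉ A → 0 < γ G w ⬝ᵥ u') → ∀ H ∈ FF V q, A ⊆ H →
      b H ⬝ᵥ u' ≤ b G ⬝ᵥ u' ∧ (b H ⬝ᵥ u' = b G ⬝ᵥ u' → G ⊆ H) := by
    intro A hA u' G hG hp H hH hAH
    have hG' := ((m𝒢 G).1 hG).2.1
    have := facet_max (hb G hG').2 ((hγ G hG).2 u') hp (hb H hH).1
      (by rw [(hb H hH).2]; exact hAH)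
    rwa [(hb H hH).2] at this
  have hunique : ∀ A ∈ FF V q, ∀ u' : Fin d → ℝ, ∀ G ∈ 𝒢, ∀ H ∈ 𝒢, A ⊆ G → A ⊆ H →
      (∀ w ∈ G, w ∉ A → 0 < γ G w ⬝ᵥ u') → (∀ w ∈ H, w ∉ A → 0 < γ H w ⬝ᵥ u') → G = H := by
    intro A hA u' G hG H hH hAG hAH hpG hpH
    have hG' := ((m𝒢 G).1 hG).2
    have hH' := ((m𝒢 H).1 hH).2
    have h1 := hmaxx A hA u' G hG hpG H hH'.1 hAH
    have h2 := hmaxx A hA u' H hH hpH G hG'.1 hAG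
    exact huniq G H hG'.1 hH'.1 hG'.2 (h1.2 (le_antisymm h1.1 h2.1))
  let N : Finset ι → Finset ι := fun G => G.filter (fun w => γ G w ⬝ᵥ u < 0)
  let M : Finset ι → Finset ι := fun G => G.filter (fun w => 0 < γ G w ⬝ᵥ u)
  have hNM : ∀ G ∈ 𝒢, (M G).card = d - (N G).card := by
    intro G hG
    have := Finset.card_filter_add_card_filter_not (s := G) (fun w => γ G w ⬝ᵥ u < 0)
    rw [hc G hG] at this
    have h2 : G.filter (fun w => ¬ γ G w ⬝ᵥ u < 0) = M G := by
      refine Finset.filter_congr fun w hw => ?_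
      rw [not_lt]
      exact ⟨fun h => lt_of_le_of_ne h (hgen' G hG w hw).symm, fun h => h.le⟩
    rw [h2] at this
    simp only [N]
    omega
  have exN : ∀ A ∈ (FF V q).erase F, ∃ G, G ∈ 𝒢 ∧ A ⊆ G ∧ ∀ w ∈ G, w ∉ A → 0 < γ G w ⬝ᵥ (-u) := by
    intro A hA
    obtain ⟨hAF, hA⟩ := Finset.mem_erase.1 hA
    refine hexist A hA (-u) (fun G hG w hw => ?_) (fun _ => ?_)
    · rw [dotProduct_neg]; exact neg_ne_zero.2 (hgen' G hG w hw)
    · rw [dotProduct_neg, dotProduct_neg]; exact neg_lt_neg (huA A hA hAF)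
  refine ⟨𝒢, fun G => (N G).card, ?_, ?_, ?_, ?_⟩
  · intro G hG
    rw [← hc G hG]
    exact Finset.card_le_card (Finset.filter_subset _ _)
  · intro A hA
    obtain ⟨G, hG, hAG, _⟩ := exN A hA
    have hli : LinearIndependent ℝ (fun w : A => q w) := by
      rw [Fintype.linearIndependent_iff]
      intro g hg w
      have h1 : γ G w ⬝ᵥ (∑ w' : A, g w' • q w') = 0 := by rw [hg]; simp
      rw [dotProduct_sum] at h1
      simp only [dotProduct_smul, smul_eq_mul] at h1
      rw [Finset.sum_congr rfl (fun (w' : A) _ => by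
        rw [(hγ G hG).1 w.1 (hAG w.2) w'.1 (hAG w'.2)])] at h1
      simpa [← Subtype.ext_iff] using h1
    have := finrank_span_eq_card hli
    rw [Fintype.card_coe] at this
    have hr : Set.range (fun w : A => q w) = q '' (A : Set ι) := by ext x; simp
    rwa [hr] at this
  · intro i hi
    have := count_dir ((FF V q).erase F) 𝒢 N (fun G _ => Finset.filter_subset _ _) hc
      (fun _ => True) hsub (fun A hA _ => ?_) (fun A hA h => absurd trivial h) i hi
    · simpa using this
    · obtain ⟨G, hG, hAG, hp⟩ := exN A hA
      refine ⟨G, ⟨hG, hAG, fun w hw hwA => ?_⟩, ?_⟩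
      · refine Finset.mem_filter.2 ⟨hw, ?_⟩
        have := hp w hw hwA
        rw [dotProduct_neg] at this; linarith
      · rintro H ⟨hH, hAH, hpH⟩
        refine hunique A (Finset.mem_erase.1 hA).2 (-u) H hH G hG hAH hAG (fun w hw hwA => ?_) hp
        have := (Finset.mem_filter.1 (hpH w hw hwA)).2
        rw [dotProduct_neg]; linarith
  · intro i hi
    have hsum : ∑ G ∈ 𝒢, (d - (N G).card).choose (d - i)
        = ∑ G ∈ 𝒢, (M G).card.choose (d - i) :=
      Finset.sum_congr rfl (fun G hG => by rw [hNM G hG])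
    refine Eq.trans ?_ hsum.symm
    have hh := count_dir ((FF V q).erase F) 𝒢 M (fun G _ => Finset.filter_subset _ _) hc
      (fun A => ¬ A ⊆ F) hsub (fun A hA hAF => ?_) (fun A hA h G hG hAG hp => ?_) i hi
    · convert hh
    · have hA' := (Finset.mem_erase.1 hA).2
      obtain ⟨G, hG, hAG, hp⟩ := hexist A hA' u hgen' (fun h => absurd h hAF)
      refine ⟨G, ⟨hG, hAG, fun w hw hwA => Finset.mem_filter.2 ⟨hw, hp w hw hwA⟩⟩, ?_⟩
      rintro H ⟨hH, hAH, hpH⟩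
      exact hunique A hA' u H hH G hG hAH hAG
        (fun w hw hwA => (Finset.mem_filter.1 (hpH w hw hwA)).2) hp
    · have hG' := (m𝒢 G).1 hG
      have := hmaxx A (Finset.mem_erase.1 hA).2 u G hG
        (fun w hw hwA => (Finset.mem_filter.1 (hp w hw hwA)).2) F hF (not_not.1 h)
      have := huA G hG'.2.1 hG'.1
      linarith

end config2

section arith

lemma arithA (d m k : ℕ) (hm : m ≤ d) (hk : k ≤ d) :
    ∑ i ∈ Finset.range (k + 1), (-1 : ℤ) ^ (k - i) * ((d - i).choose (k - i) : ℤ)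
      * (m.choose (d - i) : ℤ) = if m = d - k then 1 else 0 := by
  rw [← Finset.sum_range_reflect]
  have h1 : ∀ j ∈ Finset.range (k + 1),
      (-1 : ℤ) ^ (k - (k + 1 - 1 - j)) * ((d - (k + 1 - 1 - j)).choose (k - (k + 1 - 1 - j)) : ℤ)
      * (m.choose (d - (k + 1 - 1 - j)) : ℤ)
      = (m.choose (d - k) : ℤ) * ((-1) ^ j * ((m - (d - k)).choose j : ℤ)) := by
    intro j hj
    have hj : j ≤ k := by simpa [Nat.lt_succ_iff] using hj
    have e1 : k - (k + 1 - 1 - j) = j := by omega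
    have e2 : d - (k + 1 - 1 - j) = d - k + j := by omega
    rw [e1, e2]
    have := Nat.choose_mul (n := m) (k := d - k + j) (s := d - k) (by omega)
    rw [Nat.choose_symm_add, Nat.add_sub_cancel_left] at this
    have h' : (m.choose (d - k + j) : ℤ) * ((d - k + j).choose j : ℤ)
      = (m.choose (d - k) : ℤ) * ((m - (d - k)).choose j : ℤ) := by exact_mod_cast this
    linear_combination (-1 : ℤ) ^ j * h'
  rw [Finset.sum_congr rfl h1, ← Finset.mul_sum]
  rcases lt_or_ge m (d - k) with hlt | hge
  · rw [Nat.choose_eq_zero_of_lt hlt, if_neg (by omega)]; simp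
  · have h2 : ∑ j ∈ Finset.range (k + 1), (-1 : ℤ) ^ j * ((m - (d - k)).choose j : ℤ)
        = ∑ j ∈ Finset.range (m - (d - k) + 1), (-1 : ℤ) ^ j * ((m - (d - k)).choose j : ℤ) := by
      symm
      refine Finset.sum_subset (fun x hx => ?_) (fun x _ hx => ?_)
      · simp only [Finset.mem_range] at *; omega
      · simp only [Finset.mem_range, not_lt] at hx
        rw [Nat.choose_eq_zero_of_lt (by omega)]; simp
    rw [h2, Int.alternating_sum_range_choose]
    by_cases h : m = d - k
    · simp [h]
    · rw [if_neg (by omega), if_neg h]; simp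

lemma arithB (d n k e : ℕ) (hk : k ≤ d) (he : (e : ℤ) = n + k - d - 1) :
    ∑ i ∈ Finset.range (k + 1), (-1 : ℤ) ^ (k - i) * ((d - i).choose (k - i) : ℤ)
      * (n.choose i : ℤ) = (e.choose k : ℤ) := by
  rw [← Ring.choose_natCast (R := ℤ) e k, he,
    show (n + k - d - 1 : ℤ) = (n : ℤ) + (-(d + 1 - k : ℤ)) by ring,
    Ring.add_choose_eq k (Commute.all _ _), Finset.Nat.sum_antidiagonal_eq_sum_range_succ_mk]
  refine Finset.sum_congr rfl fun i hi => ?_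
  have hi : i ≤ k := by simpa [Nat.lt_succ_iff] using hi
  simp only
  rw [Ring.choose_natCast, Ring.choose_neg,
    show ((d : ℤ) + 1 - k + ((k - i : ℕ) : ℤ) - 1) = ((d - i : ℕ) : ℤ) by
      push_cast [hi, hi.trans hk]; ring, Ring.choose_natCast]
  rw [Int.negOnePow_def]
  simp [Units.smul_def]
  ring

end arith

section bridge

open scoped Classical Topology
open Filter Matrix

variable {d : ℕ}

lemma poly_setup (P : Set (Fin d → ℝ)) (hP : IsPolytope P) (hd : polyDim P = d) (hd1 : 1 ≤ d) :
    ∃ V : Finset (Fin d → ℝ), (V : Set (Fin d → ℝ)) = verts P ∧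
      P = convexHull ℝ (V : Set (Fin d → ℝ)) ∧
      ∃ (o : Fin d → ℝ) (r : ℝ), 0 < r ∧
        ∀ i, o + Pi.single i r ∈ P ∧ o - Pi.single i r ∈ P := by
  obtain ⟨W, rfl⟩ := hP
  have hfin : (verts (convexHull ℝ (W : Set (Fin d → ℝ)))).Finite :=
    W.finite_toSet.subset extremePoints_convexHull_subset
  refine ⟨hfin.toFinset, hfin.coe_toFinset, ?_, ?_⟩
  · rw [hfin.coe_toFinset]
    have := closure_convexHull_extremePoints (W.finite_toSet.isCompact_convexHull ℝ)
      (convex_convexHull ℝ (W : Set (Fin d → ℝ)))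
    change closure (convexHull ℝ (verts _)) = _ at this
    rw [(hfin.isClosed_convexHull ℝ).closure_eq] at this
    exact this.symm
  · have hne : (convexHull ℝ (W : Set (Fin d → ℝ))).Nonempty := by
      by_contra h
      rw [Set.not_nonempty_iff_eq_empty] at h
      rw [polyDim, h, AffineSubspace.span_empty, AffineSubspace.direction_bot, finrank_bot] at hd
      omega
    have htop : affineSpan ℝ (convexHull ℝ (W : Set (Fin d → ℝ))) = ⊤ := by
      rw [← AffineSubspace.direction_eq_top_iff_of_nonempty
        ((affineSpan_nonempty ℝ).2 hne)]
      apply Submodule.eq_top_of_finrank_eq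
      rw [polyDim] at hd
      rw [hd]; simp
    obtain ⟨o, ho⟩ := ((convex_convexHull ℝ _).interior_nonempty_iff_affineSpan_eq_top).2 htop
    rw [mem_interior_iff_mem_nhds, Metric.mem_nhds_iff] at ho
    obtain ⟨ε, hε, hb⟩ := ho
    refine ⟨o, ε / 2, by positivity, fun i => ⟨hb ?_, hb ?_⟩⟩
    · rw [Metric.mem_ball, dist_eq_norm, add_sub_cancel_left, Pi.norm_single, Real.norm_eq_abs,
        abs_of_pos (by positivity)]; linarith
    · rw [Metric.mem_ball, dist_eq_norm, sub_sub_cancel_left, norm_neg, Pi.norm_single,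
        Real.norm_eq_abs, abs_of_pos (by positivity)]; linarith

/-- shifted points -/
def qq (o : Fin d → ℝ) : (Fin d → ℝ) → Fin d → ℝ := fun v => v - o

lemma DD_le {V : Finset (Fin d → ℝ)} {o β x : Fin d → ℝ} (hβ : β ∈ DD V (qq o))
    (hx : x ∈ convexHull ℝ (V : Set (Fin d → ℝ))) : β ⬝ᵥ (x - o) ≤ 1 := by
  have hc : Convex ℝ {x : Fin d → ℝ | β ⬝ᵥ (x - o) ≤ 1} := by
    have : {x : Fin d → ℝ | β ⬝ᵥ (x - o) ≤ 1}
        = {x | (dotProductEquiv ℝ (Fin d) β) x ≤ 1 + β ⬝ᵥ o} := by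
      ext x
      show β ⬝ᵥ (x - o) ≤ 1 ↔ β ⬝ᵥ x ≤ 1 + β ⬝ᵥ o
      rw [dotProduct_sub, sub_le_iff_le_add]
    rw [this]
    exact convex_halfSpace_le (LinearMap.isLinear _) _
  exact convexHull_min (fun v hv => hβ v hv) hc hx

lemma face_eq_s15 {V : Finset (Fin d → ℝ)} {o β : Fin d → ℝ} (hβ : β ∈ DD V (qq o)) :
    {x ∈ convexHull ℝ (V : Set (Fin d → ℝ)) | β ⬝ᵥ (x - o) = 1}
      = convexHull ℝ (TT V (qq o) β : Set (Fin d → ℝ)) := by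
  apply Set.Subset.antisymm
  · rintro x ⟨hx, hx1⟩
    obtain ⟨w, hw0, hw1, hwx⟩ := Finset.mem_convexHull'.1 hx
    have hnn : ∀ y ∈ V, 0 ≤ w y * (1 - β ⬝ᵥ (y - o)) := fun y hy =>
      mul_nonneg (hw0 y hy) (by have := hβ y hy; simp only [qq] at this; linarith)
    have hsum : ∑ y ∈ V, w y * (1 - β ⬝ᵥ (y - o)) = 0 := by
      have h1 : x - o = ∑ y ∈ V, w y • (y - o) := by
        simp only [smul_sub, Finset.sum_sub_distrib, hwx, ← Finset.sum_smul, hw1, one_smul]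
      rw [h1, dotProduct_sum] at hx1
      simp only [dotProduct_smul, smul_eq_mul] at hx1
      simp only [mul_sub, mul_one, Finset.sum_sub_distrib, hw1]
      linarith [hx1]
    have hz := (Finset.sum_eq_zero_iff_of_nonneg hnn).1 hsum
    have hz' : ∀ y ∈ V, y ∉ TT V (qq o) β → w y = 0 := by
      intro y hy hyT
      rcases mul_eq_zero.1 (hz y hy) with h | h
      · exact h
      · exact absurd (mem_TT.2 ⟨hy, by simp only [qq]; linarith⟩) hyT
    have hsub : TT V (qq o) β ⊆ V := Finset.filter_subset _ _
    refine Finset.mem_convexHull'.2 ⟨w, fun y hy => hw0 y (hsub hy), ?_, ?_⟩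
    · rw [← hw1]
      exact Finset.sum_subset hsub hz'
    · rw [← hwx]
      exact Finset.sum_subset hsub fun y hy hyT => by rw [hz' y hy hyT, zero_smul]
  · have hc : Convex ℝ {x : Fin d → ℝ | β ⬝ᵥ (x - o) = 1} := by
      have : {x : Fin d → ℝ | β ⬝ᵥ (x - o) = 1}
          = {x | (dotProductEquiv ℝ (Fin d) β) x = 1 + β ⬝ᵥ o} := by
        ext x
        show β ⬝ᵥ (x - o) = 1 ↔ β ⬝ᵥ x = 1 + β ⬝ᵥ o
        rw [dotProduct_sub, sub_eq_iff_eq_add]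
      rw [this]
      exact convex_hyperplane (LinearMap.isLinear _) _
    intro x hx
    refine ⟨convexHull_mono (by exact_mod_cast Finset.filter_subset _ _) hx, ?_⟩
    exact convexHull_min (fun v hv => (mem_TT.1 hv).2) hc hx

lemma face_verts {V : Finset (Fin d → ℝ)} {o β : Fin d → ℝ}
    (hV : (V : Set (Fin d → ℝ)) = verts (convexHull ℝ (V : Set (Fin d → ℝ))))
    (hβ : β ∈ DD V (qq o)) :
    verts (convexHull ℝ (TT V (qq o) β : Set (Fin d → ℝ))) = TT V (qq o) β := by
  have hext : IsExtreme ℝ (convexHull ℝ (V : Set (Fin d → ℝ)))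
      {x ∈ convexHull ℝ (V : Set (Fin d → ℝ)) | β ⬝ᵥ (x - o) = 1} := by
    refine ⟨fun x hx => hx.1, ?_⟩
    rintro x1 h1 x2 h2 x ⟨hx, hx1⟩ ⟨a, b, ha, hb, hab, rfl⟩
    refine ⟨h1, le_antisymm (DD_le hβ h1) ?_⟩
    have e2 := DD_le hβ h2
    have e1 := DD_le hβ h1
    have : a • x1 + b • x2 - o = a • (x1 - o) + b • (x2 - o) := by
      have : o = (a + b) • o := by rw [hab, one_smul]
      conv_lhs => rw [this]
      module
    rw [this, dotProduct_add, dotProduct_smul, dotProduct_smul, smul_eq_mul, smul_eq_mul] at hx1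
    by_contra hlt
    push Not at hlt
    nlinarith
  have := hext.extremePoints_eq
  rw [face_eq_s15 hβ] at this
  rw [verts, this]
  change _ ∩ verts _ = _
  rw [← hV, ← face_eq_s15 hβ]
  ext x
  simp only [Set.mem_inter_iff, Finset.mem_coe, mem_TT]
  constructor
  · rintro ⟨⟨_, h⟩, hv⟩; exact ⟨hv, h⟩
  · rintro ⟨hv, h⟩; exact ⟨⟨subset_convexHull ℝ _ hv, h⟩, hv⟩

lemma face_isFace {V : Finset (Fin d → ℝ)} {o β : Fin d → ℝ} (hβ : β ∈ DD V (qq o)) :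
    IsFaceOf (convexHull ℝ (V : Set (Fin d → ℝ)))
      (convexHull ℝ (TT V (qq o) β : Set (Fin d → ℝ))) := by
  by_cases h0 : β = 0
  · left
    have : TT V (qq o) β = ∅ := by
      rw [Finset.eq_empty_iff_forall_notMem]
      intro v hv
      have := (mem_TT.1 hv).2
      simp [h0] at this
    simp [this]
  · right; right
    refine ⟨β, 1 + β ⬝ᵥ o, h0, fun x hx => ?_, ?_⟩
    · have := DD_le hβ hx
      rw [dotProduct_sub] at this
      show β ⬝ᵥ x ≤ _
      linarith
    · rw [← face_eq_s15 hβ]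
      ext x
      show _ ∧ _ ↔ _ ∧ _
      refine and_congr_right fun _ => ?_
      show β ⬝ᵥ (x - o) = 1 ↔ β ⬝ᵥ x = 1 + β ⬝ᵥ o
      rw [dotProduct_sub, sub_eq_iff_eq_add]

lemma face_norm {V : Finset (Fin d → ℝ)} {o : Fin d → ℝ} {r : ℝ} (hr : 0 < r)
    (ho : ∀ i, o + Pi.single i r ∈ convexHull ℝ (V : Set (Fin d → ℝ)) ∧
      o - Pi.single i r ∈ convexHull ℝ (V : Set (Fin d → ℝ)))
    {G : Set (Fin d → ℝ)} (hG : IsFaceOf (convexHull ℝ (V : Set (Fin d → ℝ))) G)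
    (hGP : G ≠ convexHull ℝ (V : Set (Fin d → ℝ))) :
    ∃ A ∈ FF V (qq o), G = convexHull ℝ (A : Set (Fin d → ℝ)) := by
  rcases hG with rfl | h | ⟨b, c, hb, hle, rfl⟩
  · refine ⟨∅, mem_FF.2 ⟨0, fun v _ => by simp, ?_⟩, by simp⟩
    simp [TT]
  · exact absurd h hGP
  · obtain ⟨i, hi⟩ := Function.ne_iff.1 hb
    have hi : b i ≠ 0 := hi
    have h1 : b ⬝ᵥ (o + Pi.single i r) ≤ c := hle _ (ho i).1
    have h2 : b ⬝ᵥ (o - Pi.single i r) ≤ c := hle _ (ho i).2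
    rw [dotProduct_add, dotProduct_single] at h1
    rw [dotProduct_sub, dotProduct_single] at h2
    have hpos : 0 < c - b ⬝ᵥ o := by
      rcases lt_or_gt_of_ne hi with h | h <;> nlinarith
    have hval : ∀ x : Fin d → ℝ, ((c - b ⬝ᵥ o)⁻¹ • b) ⬝ᵥ (x - o)
        = (b ⬝ᵥ x - b ⬝ᵥ o) / (c - b ⬝ᵥ o) := by
      intro x
      rw [smul_dotProduct, dotProduct_sub, smul_eq_mul]; ring
    have hD : (c - b ⬝ᵥ o)⁻¹ • b ∈ DD V (qq o) := by
      intro v hv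
      have : b ⬝ᵥ v ≤ c := hle v (subset_convexHull ℝ _ hv)
      rw [qq, hval, div_le_one hpos]; linarith
    refine ⟨_, mem_FF.2 ⟨_, hD, rfl⟩, ?_⟩
    rw [← face_eq_s15 hD]
    ext x
    show _ ∧ _ ↔ _ ∧ _
    refine and_congr_right fun _ => ?_
    rw [hval, div_eq_one_iff_eq hpos.ne']
    show b ⬝ᵥ x = c ↔ _
    constructor <;> intro h <;> linarith

lemma polyDim_face {V : Finset (Fin d → ℝ)} {o : Fin d → ℝ} {A : Finset (Fin d → ℝ)}
    (hA : A ∈ FF V (qq o)) (hne : A.Nonempty) :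
    polyDim (convexHull ℝ (A : Set (Fin d → ℝ))) + 1
      = Module.finrank ℝ (Submodule.span ℝ (qq o '' A)) := by
  obtain ⟨β, hβ, hT⟩ := mem_FF.1 hA
  obtain ⟨p, hp⟩ := hne
  have h1 : ∀ v ∈ A, β ⬝ᵥ (v - o) = 1 := fun v hv => by
    rw [← hT] at hv; exact (mem_TT.1 hv).2
  rw [polyDim, affineSpan_convexHull, direction_affineSpan,
    vectorSpan_eq_span_vsub_set_right ℝ (Finset.mem_coe.2 hp)]
  set S := Submodule.span ℝ ((fun x => x -ᵥ p) '' (A : Set (Fin d → ℝ))) with hS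
  have hne0 : p - o ≠ 0 := by
    intro h
    have := h1 p hp
    rw [h] at this; simp at this
  have hker : ∀ x ∈ S, β ⬝ᵥ x = 0 := by
    have : S ≤ LinearMap.ker (dotProductEquiv ℝ (Fin d) β) := by
      rw [hS, Submodule.span_le]
      rintro _ ⟨v, hv, rfl⟩
      show β ⬝ᵥ (v - p) = 0
      have e1 := h1 v hv
      have e2 := h1 p hp
      rw [dotProduct_sub] at *
      linarith
    exact fun x hx => this hx
  have hinf : S ⊓ Submodule.span ℝ {p - o} = ⊥ := by
    rw [eq_bot_iff]
    rintro x ⟨hx1, hx2⟩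
    obtain ⟨a, rfl⟩ := Submodule.mem_span_singleton.1 hx2
    have := hker _ hx1
    rw [dotProduct_smul, h1 p hp] at this
    have ha : a = 0 := by simpa using this
    simp [ha]
  have hsup : S ⊔ Submodule.span ℝ {p - o} = Submodule.span ℝ (qq o '' A) := by
    apply le_antisymm
    · apply sup_le
      · rw [hS, Submodule.span_le]
        rintro _ ⟨v, hv, rfl⟩
        have : v -ᵥ p = qq o v - qq o p := by simp [qq]
        simp only [this]
        exact Submodule.sub_mem _ (Submodule.subset_span ⟨v, hv, rfl⟩)
          (Submodule.subset_span ⟨p, hp, rfl⟩)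
      · rw [Submodule.span_le]
        rintro _ rfl
        exact Submodule.subset_span ⟨p, hp, rfl⟩
    · rw [Submodule.span_le]
      rintro _ ⟨v, hv, rfl⟩
      have : qq o v = (v -ᵥ p) + (p - o) := by simp [qq]
      rw [this]
      exact Submodule.add_mem_sup (Submodule.subset_span ⟨v, hv, rfl⟩)
        (Submodule.mem_span_singleton_self _)
  have := Submodule.finrank_sup_add_finrank_inf_eq S (Submodule.span ℝ {p - o})
  rw [hinf, hsup, finrank_bot, finrank_span_singleton hne0] at this
  omega

end bridge

section final

open scoped Classical
open Matrix

set_option maxHeartbeats 1000000 in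
theorem asp_main (d n s : ℕ) (P F : Set (Fin d → ℝ)) (hd1 : 1 ≤ d)
    (hPF : IsASPPair P F) (hn : (verts P).ncard = n) (hF : (verts F).ncard = d + s)
    (hnbl : IsNeighborly ((d - 1) / 2) P) :
    (∀ k : ℕ, k ≤ (d - 1) / 2 → hBall P (k : ℤ) = ((n - d - 1 + k).choose k : ℤ)) ∧
    (∀ k : ℕ, 1 ≤ k → k ≤ (d - 1) / 2 →
      hBall P ((d : ℤ) - k)
        = ((n - d - 1 + k).choose k : ℤ) - ((s + k - 1).choose k : ℤ)) := by
  obtain ⟨hpoly, hdim, hFfac, hother⟩ := hPF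
  obtain ⟨V, hV, hPV, o, r, hr, ho⟩ := poly_setup P hpoly hdim hd1
  subst hPV
  obtain ⟨hFface, hFne, hFdim⟩ := hFfac
  have hFP : F ≠ convexHull ℝ (V : Set (Fin d → ℝ)) := by
    rintro rfl
    rw [hdim] at hFdim; omega
  obtain ⟨F₀, hF₀, rfl⟩ := face_norm hr ho hFface hFP
  have hvA : ∀ A ∈ FF V (qq o), verts (convexHull ℝ (A : Set (Fin d → ℝ))) = A := by
    intro A hA
    obtain ⟨β, hβ, rfl⟩ := mem_FF.1 hA
    exact face_verts hV hβ
  have hinj : ∀ A ∈ FF V (qq o), ∀ B ∈ FF V (qq o),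
      convexHull ℝ (A : Set (Fin d → ℝ)) = convexHull ℝ (B : Set (Fin d → ℝ)) → A = B := by
    intro A hA B hB h
    have := hvA A hA
    rw [h, hvA B hB] at this
    exact_mod_cast this.symm
  have hfaceA : ∀ A ∈ FF V (qq o), IsFaceOf (convexHull ℝ (V : Set (Fin d → ℝ)))
      (convexHull ℝ (A : Set (Fin d → ℝ))) := by
    intro A hA
    obtain ⟨β, hβ, rfl⟩ := mem_FF.1 hA
    exact face_isFace hβ
  have hsubV : ∀ A ∈ FF V (qq o), A ⊆ V := by
    intro A hA
    obtain ⟨β, hβ, rfl⟩ := mem_FF.1 hA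
    exact Finset.filter_subset _ _
  have hF₀ne : F₀.Nonempty := by
    rw [convexHull_nonempty_iff] at hFne
    exact_mod_cast hFne
  have hF₀s : Submodule.span ℝ (qq o '' (F₀ : Set (Fin d → ℝ))) = ⊤ := by
    apply Submodule.eq_top_of_finrank_eq
    rw [← polyDim_face hF₀ hF₀ne, hFdim]
    simp; omega
  have hF₀c : F₀.card = d + s := by
    rw [hvA F₀ hF₀, Set.ncard_coe_finset] at hF
    exact hF
  have hVc : V.card = n := by
    rw [← hV, Set.ncard_coe_finset] at hn
    exact hn
  have hnd : d + s < n := by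
    rw [← hF₀c, ← hVc]
    refine Finset.card_lt_card ((hsubV F₀ hF₀).ssubset_of_ne ?_)
    rintro rfl
    exact hFP rfl
  have hsimp : ∀ A ∈ FF V (qq o), Submodule.span ℝ (qq o '' (A : Set (Fin d → ℝ))) = ⊤ →
      A ≠ F₀ → A.card = d := by
    intro A hA hs hne
    have hAne : A.Nonempty := by
      rw [Finset.nonempty_iff_ne_empty]
      rintro rfl
      have : Module.finrank ℝ (⊤ : Submodule ℝ (Fin d → ℝ)) = 0 := by rw [← hs]; simp
      simp at this
      omega
    have h1 := polyDim_face hA hAne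
    rw [hs] at h1
    simp only [finrank_top, Module.finrank_fin_fun] at h1
    have h2 := hother (convexHull ℝ (A : Set (Fin d → ℝ)))
      ⟨hfaceA A hA, by rw [convexHull_nonempty_iff]; exact_mod_cast hAne, by omega⟩
      (fun h => hne (hinj A hA F₀ hF₀ h))
    rwa [hvA A hA, Set.ncard_coe_finset] at h2
  have hR : ∀ β ∈ DD V (qq o), ∀ i, |β i| ≤ 1 / r := by
    intro β hβ i
    have h1 := DD_le hβ (ho i).1
    have h2 := DD_le hβ (ho i).2
    rw [add_sub_cancel_left, dotProduct_single] at h1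
    rw [sub_sub_cancel_left, dotProduct_neg, dotProduct_single] at h2
    rw [abs_le, le_div_iff₀ hr, neg_le, le_div_iff₀ hr]
    constructor <;> linarith
  obtain ⟨𝒢, m, hmd, hrank, hcnt, hcnt'⟩ := config_main V (qq o) (1 / r) hR F₀ hF₀ hF₀s hsimp
  set X := (FF V (qq o)).erase F₀ with hX
  replace hrank : ∀ A ∈ X,
      Module.finrank ℝ (Submodule.span ℝ (qq o '' (A : Set (Fin d → ℝ)))) = A.card := by
    intro A hA
    apply hrank A
    convert hA using 1
    rw [hX]
    congr!
  replace hcnt : ∀ i, i ≤ d → (X.filter (fun A : Finset (Fin d → ℝ) => A.card = i)).card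
      = ∑ G ∈ 𝒢, (m G).choose (d - i) := by
    intro i hi
    rw [← hcnt i hi]
    congr!
  replace hcnt' : ∀ i, i ≤ d →
      (X.filter (fun A : Finset (Fin d → ℝ) => A.card = i ∧ ¬ A ⊆ F₀)).card
      = ∑ G ∈ 𝒢, (d - m G).choose (d - i) := by
    intro i hi
    rw [← hcnt' i hi]
    congr!
  have hempty : (∅ : Finset (Fin d → ℝ)) ∈ X := by
    rw [hX, Finset.mem_erase]
    refine ⟨fun h => ?_, mem_FF.2 ⟨0, fun v _ => by simp, by simp [TT]⟩⟩
    rw [← h] at hF₀ne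
    simp at hF₀ne
  -- face counts
  have hfv : ∀ j, j < d → fVec (convexHull ℝ (V : Set (Fin d → ℝ))) j
      = ((FF V (qq o)).filter (fun A : Finset (Fin d → ℝ) => A.Nonempty ∧
          polyDim (convexHull ℝ (A : Set (Fin d → ℝ))) = j)).card := by
    intro j hj
    rw [fVec, ← Set.ncard_coe_finset, ← Set.ncard_image_of_injOn
      (f := fun A : Finset (Fin d → ℝ) => convexHull ℝ (A : Set (Fin d → ℝ)))]
    · congr 1
      ext G
      constructor
      · rintro ⟨hG, hGne, hGd⟩
        obtain ⟨A, hA, rfl⟩ := face_norm hr ho hG (by rintro rfl; rw [hdim] at hGd; omega)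
        refine ⟨A, ?_, rfl⟩
        rw [convexHull_nonempty_iff] at hGne
        exact Finset.mem_coe.2 (Finset.mem_filter.2 ⟨hA, by exact_mod_cast hGne, hGd⟩)
      · rintro ⟨A, hA, rfl⟩
        obtain ⟨hA, hne, hAd⟩ := Finset.mem_filter.1 (Finset.mem_coe.1 hA)
        refine ⟨hfaceA A hA, ?_, hAd⟩
        rw [convexHull_nonempty_iff]
        exact_mod_cast hne
    · intro A hA B hB h
      exact hinj A (Finset.mem_filter.1 (Finset.mem_coe.1 hA)).1 B
        (Finset.mem_filter.1 (Finset.mem_coe.1 hB)).1 h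
  have hXd : ∀ A ∈ X, A.Nonempty →
      polyDim (convexHull ℝ (A : Set (Fin d → ℝ))) + 1 = A.card := by
    intro A hA hne
    rw [polyDim_face (Finset.mem_erase.1 hA).2 hne, hrank A hA]
  have hfil : ∀ j, X.filter (fun A : Finset (Fin d → ℝ) => A.Nonempty ∧
      polyDim (convexHull ℝ (A : Set (Fin d → ℝ))) = j) = X.filter (fun A : Finset (Fin d → ℝ) => A.card = j + 1) := by
    intro j
    refine Finset.filter_congr fun A hA => ?_
    constructor
    · rintro ⟨hne, h⟩
      rw [← hXd A hA hne, h]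
    · intro h
      have hne : A.Nonempty := Finset.card_pos.1 (by omega)
      have := hXd A hA hne
      exact ⟨hne, by omega⟩
  have hFFX : FF V (qq o) = insert F₀ X := (Finset.insert_erase hF₀).symm
  have hfB : ∀ i, i ≤ d → fBall (convexHull ℝ (V : Set (Fin d → ℝ))) i
      = ((X.filter (fun A : Finset (Fin d → ℝ) => A.card = i)).card : ℤ) := by
    intro i hi
    unfold fBall
    split_ifs with h0 h1 h2
    · subst h0
      have : X.filter (fun A : Finset (Fin d → ℝ) => A.card = 0) = {∅} := by
        ext A
        simp only [Finset.mem_filter, Finset.card_eq_zero, Finset.mem_singleton]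
        exact ⟨fun h => h.2, fun h => ⟨h ▸ hempty, h⟩⟩
      rw [this]; simp
    · subst h1
      rw [hfv (i - 1) (by omega), hFFX, Finset.filter_insert, if_pos ⟨hF₀ne, hFdim⟩,
        Finset.card_insert_of_notMem (by simp [hX]), hfil, Nat.sub_add_cancel hd1]
      push_cast; ring
    · omega
    · rw [hfv (i - 1) (by omega), hFFX, Finset.filter_insert,
        if_neg (fun h => by have := h.2; rw [hFdim] at this; omega), hfil,
        Nat.sub_add_cancel (by omega)]
  -- neighborliness
  have hnb : ∀ S : Finset (Fin d → ℝ), S ⊆ V → S.card ≤ (d - 1) / 2 → S ∈ X := by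
    intro S hS hc
    obtain ⟨G, hG, hGS⟩ := hnbl S (by rw [← hV]; exact_mod_cast hS) hc
    have hGP : G ≠ convexHull ℝ (V : Set (Fin d → ℝ)) := by
      rintro rfl
      rw [← hV] at hGS
      have : V = S := by exact_mod_cast hGS
      rw [← this] at hc
      omega
    obtain ⟨A, hA, rfl⟩ := face_norm hr ho hG hGP
    rw [hvA A hA] at hGS
    have : A = S := by exact_mod_cast hGS
    subst this
    refine Finset.mem_erase.2 ⟨?_, hA⟩
    rintro rfl
    omega
  have hf : ∀ i, i ≤ (d - 1) / 2 → (X.filter (fun A : Finset (Fin d → ℝ) => A.card = i)).card = n.choose i := by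
    intro i hi
    rw [← hVc, ← Finset.card_powersetCard]
    congr 1
    ext A
    rw [Finset.mem_filter, Finset.mem_powersetCard]
    exact ⟨fun h => ⟨hsubV A (Finset.mem_erase.1 h.1).2, h.2⟩,
      fun h => ⟨hnb A h.1 (h.2.le.trans hi), h.2⟩⟩
  have hphi : ∀ i, i ≤ (d - 1) / 2 →
      ((X.filter (fun A : Finset (Fin d → ℝ) => A.card = i ∧ ¬ A ⊆ F₀)).card : ℤ)
        = (n.choose i : ℤ) - ((d + s).choose i : ℤ) := by
    intro i hi
    have h1 := Finset.card_filter_add_card_filter_not (s := X.filter (fun A : Finset (Fin d → ℝ) => A.card = i))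
      (fun A : Finset (Fin d → ℝ) => A ⊆ F₀)
    rw [Finset.filter_filter, Finset.filter_filter, hf i hi] at h1
    have h2 : (X.filter (fun A : Finset (Fin d → ℝ) => A.card = i ∧ A ⊆ F₀)).card = (d + s).choose i := by
      rw [← hF₀c, ← Finset.card_powersetCard]
      congr 1
      ext A
      rw [Finset.mem_filter, Finset.mem_powersetCard]
      exact ⟨fun h => ⟨h.2.2, h.2.1⟩,
        fun h => ⟨hnb A (h.1.trans (hsubV F₀ hF₀)) (h.2.le.trans hi), h.2, h.1⟩⟩
    rw [h2] at h1
    have : (((d + s).choose i : ℕ) : ℤ)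
      + ((X.filter (fun A : Finset (Fin d → ℝ) => A.card = i ∧ ¬ A ⊆ F₀)).card : ℤ) = (n.choose i : ℤ) := by
      exact_mod_cast h1
    linarith
  have hk1 : ∀ k : ℕ, k ≤ (d - 1) / 2 →
      ∑ i ∈ Finset.range (k + 1), (-1 : ℤ) ^ (k - i) * ((d - i).choose (k - i) : ℤ)
        * (n.choose i : ℤ) = ((n - d - 1 + k).choose k : ℤ) := fun k hk =>
    arithB d n k (n - d - 1 + k) (by omega) (by omega)
  refine ⟨fun k hk => ?_, fun k hk1' hk => ?_⟩
  · rw [hBall, if_pos ⟨by omega, by omega⟩, Int.toNat_natCast, ← hk1 k hk]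
    refine Finset.sum_congr rfl fun i hi => ?_
    have hi : i ≤ k := by simpa [Nat.lt_succ_iff] using hi
    rw [hfB i (by omega), hf i (by omega)]
  · have e1 : hBall (convexHull ℝ (V : Set (Fin d → ℝ))) ((d : ℤ) - k)
        = ∑ G ∈ 𝒢, if m G = k then 1 else 0 := by
      have ht : ((d : ℤ) - k).toNat = d - k := by omega
      rw [hBall, if_pos ⟨by omega, by omega⟩, ht]
      have : ∀ i ∈ Finset.range (d - k + 1),
          (-1 : ℤ) ^ (d - k - i) * ((d - i).choose (d - k - i) : ℤ)
            * fBall (convexHull ℝ (V : Set (Fin d → ℝ))) i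
          = ∑ G ∈ 𝒢, (-1 : ℤ) ^ (d - k - i) * ((d - i).choose (d - k - i) : ℤ)
            * ((m G).choose (d - i) : ℤ) := by
        intro i hi
        have hi : i ≤ d - k := by simpa [Nat.lt_succ_iff] using hi
        rw [hfB i (by omega), hcnt i (by omega), ← Finset.mul_sum]
        push_cast; rfl
      rw [Finset.sum_congr rfl this, Finset.sum_comm]
      refine Finset.sum_congr rfl fun G hG => ?_
      rw [arithA d (m G) (d - k) (hmd G hG) (by omega), Nat.sub_sub_self (by omega)]
    have e2 : ∑ i ∈ Finset.range (k + 1), (-1 : ℤ) ^ (k - i) * ((d - i).choose (k - i) : ℤ)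
        * ((n.choose i : ℤ) - ((d + s).choose i : ℤ)) = ∑ G ∈ 𝒢, if m G = k then 1 else 0 := by
      have : ∀ i ∈ Finset.range (k + 1),
          (-1 : ℤ) ^ (k - i) * ((d - i).choose (k - i) : ℤ)
            * ((n.choose i : ℤ) - ((d + s).choose i : ℤ))
          = ∑ G ∈ 𝒢, (-1 : ℤ) ^ (k - i) * ((d - i).choose (k - i) : ℤ)
            * ((d - m G).choose (d - i) : ℤ) := by
        intro i hi
        have hi : i ≤ k := by simpa [Nat.lt_succ_iff] using hi
        rw [← hphi i (by omega), hcnt' i (by omega), ← Finset.mul_sum]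
        push_cast; rfl
      rw [Finset.sum_congr rfl this, Finset.sum_comm]
      refine Finset.sum_congr rfl fun G hG => ?_
      rw [arithA d (d - m G) k (by omega) (by omega)]
      have := hmd G hG
      congr 1
      apply propext
      constructor <;> intro h <;> omega
    rw [e1, ← e2, ← hk1 k hk, ← arithB d (d + s) k (s + k - 1) (by omega) (by push_cast; omega),
      ← Finset.sum_sub_distrib]
    exact Finset.sum_congr rfl fun i _ => by ring

end final

/-- **h-numbers of neighborly almost simplicial polytopes.** Let `P ∈ 𝒫(d,n,s)` be
`⌊(d−1)/2⌋`-neighborly, with ASP-pair `(P,F)` and `P' = ∂P − {F}`. Then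
`h_k(P') = C(n−d−1+k, k)` for `0 ≤ k ≤ ⌊(d−1)/2⌋`, and
`h_{d−k}(P') = C(n−d−1+k, k) − C(s+k−1, k)` for `1 ≤ k ≤ ⌊(d−1)/2⌋`. -/
theorem neighborly_asp_h_numbers (d n s : ℕ) (P F : Set (Fin d → ℝ))
    (hPF : IsASPPair P F) (hn : (verts P).ncard = n) (hF : (verts F).ncard = d + s)
    (hnbl : IsNeighborly ((d - 1) / 2) P) :
    (∀ k : ℕ, k ≤ (d - 1) / 2 → hBall P (k : ℤ) = ((n - d - 1 + k).choose k : ℤ)) ∧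
    (∀ k : ℕ, 1 ≤ k → k ≤ (d - 1) / 2 →
      hBall P ((d : ℤ) - k)
        = ((n - d - 1 + k).choose k : ℤ) - ((s + k - 1).choose k : ℤ)) := by
  rcases Nat.eq_zero_or_pos d with h0 | h1
  · subst h0
    refine ⟨fun k hk => ?_, fun k hk1 hk => ?_⟩
    · have hk0 : k = 0 := by omega
      subst hk0
      simp [hBall, fBall]
    · omega
  · exact asp_main d n s P F h1 hPF hn hF hnbl

end

end ASP
end
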